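/- There exist constants C, c, γ > 0 and ε₀ ∈ (0,1), depending only on (δ, λ, ρ, A), such that for every n (with m = δn), every s ∈ {−1,+1}^m, and every ε ∈ (0, ε₀): P[ |min_{‖x‖∞ ≤ A} P(x; ρ) − φ(τ*, β*; ρ, A)| ≥ γε ] ≤ (C/ε)·exp(−c n ε²), where the probability is over the random matrix H. -/

import Mathlib

open MeasureTheory ProbabilityTheory Real
open scoped ENNReal NNReal

/-- The deterministic scalar function `φ(τ, β; ρ, A)`. -/
noncomputable def phiFn (δ lam ρ A τ β : ℝ) : ℝ :=
  τ * β * δ / 2 + ρ * β / (2 * τ) - β ^ 2 / 4 +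
    ∫ h : ℝ,
      sInf ((fun x : ℝ => β / (2 * τ) * x ^ 2 + lam * x ^ 2 - β * h * x) '' Set.Icc (-A) A)
      ∂(gaussianReal 0 1)

/-- `(τs, βs)` is a saddle point of `max_{β ≥ 0} min_{τ > 0} φ(τ, β; ρ, A)`. -/
def IsSaddle (δ lam ρ A τs βs : ℝ) : Prop :=
  0 < τs ∧ 0 < βs ∧
    (∀ τ : ℝ, 0 < τ → phiFn δ lam ρ A τs βs ≤ phiFn δ lam ρ A τ βs) ∧
    (∀ β : ℝ, 0 ≤ β → phiFn δ lam ρ A τs β ≤ phiFn δ lam ρ A τs βs)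

/-- Law of an `m × n` random matrix with i.i.d. centered Gaussian entries of variance `1/n`. -/
noncomputable def matMeasure (m n : ℕ) : Measure (Fin m → Fin n → ℝ) :=
  Measure.pi fun _ : Fin m => Measure.pi fun _ : Fin n => gaussianReal 0 ((n : ℝ≥0))⁻¹

/-- Matrix–vector product. -/
noncomputable def mulV {m n : ℕ} (H : Fin m → Fin n → ℝ) (x : Fin n → ℝ) : Fin m → ℝ :=
  fun k => ∑ i, H k i * x i

/-- The precoding cost `P(x; ρ) = (1/n)‖Hx − √ρ s‖² + (λ/n)‖x‖²`. -/
noncomputable def cost (m n : ℕ) (lam ρ : ℝ) (s : Fin m → ℝ)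
    (H : Fin m → Fin n → ℝ) (x : Fin n → ℝ) : ℝ :=
  (∑ k, (mulV H x k - Real.sqrt ρ * s k) ^ 2) / n + lam * (∑ i, (x i) ^ 2) / n

lemma hasDerivAt_gaussianPDFReal_std (x : ℝ) :
    HasDerivAt (gaussianPDFReal 0 1) (-(x * gaussianPDFReal 0 1 x)) x := by
  have h1 : HasDerivAt (fun y : ℝ => -y ^ 2 / 2) (-x) x := by
    have := ((hasDerivAt_pow 2 x).neg).div_const 2
    refine this.congr_deriv ?_
    push_cast
    ring
  have h2 := (h1.exp).const_mul ((√(2 * π))⁻¹)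
  have e : gaussianPDFReal 0 1 = fun y => (√(2 * π))⁻¹ * rexp (-y ^ 2 / 2) := by
    ext y; simp [gaussianPDFReal]
  rw [e]
  refine h2.congr_deriv ?_
  ring

lemma integrable_mul_gaussianPDFReal_std :
    Integrable (fun x : ℝ => x * gaussianPDFReal 0 1 x) := by
  have h := (integrable_mul_exp_neg_mul_sq (b := 1 / 2) (by norm_num)).const_mul ((√(2 * π))⁻¹)
  refine h.congr (Filter.Eventually.of_forall fun x => ?_)
  simp only [gaussianPDFReal]
  rw [mul_left_comm, NNReal.coe_one, mul_one]
  congr 3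
  ring

/-- Gaussian integration by parts on the line. -/
lemma integral_mul_gaussianReal_std {f f' : ℝ → ℝ} {C : ℝ} (hf : ∀ x, HasDerivAt f (f' x) x)
    (hC : ∀ x, |f x| ≤ C) (hC' : ∀ x, |f' x| ≤ C) (hm : Continuous f') :
    ∫ x, x * f x ∂(gaussianReal 0 1) = ∫ x, f' x ∂(gaussianReal 0 1) := by
  have hfc : Continuous f := continuous_iff_continuousAt.2 fun x => (hf x).continuousAt
  have hp := integrable_gaussianPDFReal 0 1
  have hxp := integrable_mul_gaussianPDFReal_std
  rw [integral_gaussianReal_eq_integral_smul one_ne_zero,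
    integral_gaussianReal_eq_integral_smul one_ne_zero]
  have key := integral_mul_deriv_eq_deriv_mul_of_integrable (u := f) (u' := f')
    (v := gaussianPDFReal 0 1) (v' := fun x => -(x * gaussianPDFReal 0 1 x))
    (fun x _ => hf x) (fun x _ => hasDerivAt_gaussianPDFReal_std x)
    (hxp.neg.bdd_mul hfc.aestronglyMeasurable (Filter.Eventually.of_forall hC))
    (hp.bdd_mul hm.aestronglyMeasurable (Filter.Eventually.of_forall hC'))
    (hp.bdd_mul hfc.aestronglyMeasurable (Filter.Eventually.of_forall hC))
  have e1 : ∫ x, gaussianPDFReal 0 1 x • (x * f x)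
      = -∫ x, f x * -(x * gaussianPDFReal 0 1 x) := by
    rw [← integral_neg]
    refine integral_congr_ae (Filter.Eventually.of_forall fun x => ?_)
    simp only [smul_eq_mul]; ring
  rw [e1, key, neg_neg]
  refine integral_congr_ae (Filter.Eventually.of_forall fun x => ?_)
  simp only [smul_eq_mul]; ring

/-- The standard Gaussian measure on `ι → ℝ`. -/
noncomputable abbrev stdGauss (ι : Type*) [Fintype ι] : Measure (ι → ℝ) :=
  Measure.pi fun _ : ι => gaussianReal 0 1

lemma measurePreserving_update_stdGauss {ι : Type*} [Fintype ι] [DecidableEq ι] (i : ι) :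
    MeasurePreserving (fun p : ℝ × (ι → ℝ) => Function.update p.2 i p.1)
      ((gaussianReal 0 1).prod (stdGauss ι)) (stdGauss ι) := by
  have hm : Measurable (fun p : ℝ × (ι → ℝ) => Function.update p.2 i p.1) := by
    refine measurable_pi_iff.2 fun j => ?_
    by_cases h : j = i
    · subst h; simpa using measurable_fst
    · simpa [h, Function.comp_def] using (measurable_pi_apply j).comp measurable_snd
  refine ⟨hm, ?_⟩
  symm
  refine Measure.pi_eq fun s hs => ?_
  rw [Measure.map_apply hm (MeasurableSet.univ_pi hs)]
  have e : (fun p : ℝ × (ι → ℝ) => Function.update p.2 i p.1) ⁻¹' (Set.univ.pi s)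
      = s i ×ˢ (Set.univ.pi (Function.update s i Set.univ)) := by
    ext p
    simp only [Set.mem_preimage, Set.mem_univ_pi, Set.mem_prod]
    constructor
    · intro h
      refine ⟨by simpa using h i, fun j => ?_⟩
      by_cases hj : j = i
      · subst hj; simp
      · simpa [hj] using h j
    · rintro ⟨h1, h2⟩ j
      by_cases hj : j = i
      · subst hj; simpa using h1
      · simpa [hj] using h2 j
  rw [e, Measure.prod_prod, Measure.pi_pi, ← Finset.mul_prod_erase _ _ (Finset.mem_univ i),
    ← Finset.mul_prod_erase _ (fun j => (gaussianReal 0 1) (s j)) (Finset.mem_univ i)]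
  simp only [Function.update_self, measure_univ, one_mul]
  congr 1
  refine Finset.prod_congr rfl fun j hj => ?_
  rw [Function.update_of_ne (Finset.ne_of_mem_erase hj)]

lemma integral_stdGauss_eq_integral_update {ι : Type*} [Fintype ι] [DecidableEq ι] {f : (ι → ℝ) → ℝ}
    (hf : Integrable f (stdGauss ι)) (i : ι) :
    ∫ ξ, f ξ ∂(stdGauss ι)
      = ∫ ξ, ∫ x, f (Function.update ξ i x) ∂(gaussianReal 0 1) ∂(stdGauss ι) := by
  have hmp := measurePreserving_update_stdGauss (ι := ι) i
  have h1 := hmp.integrable_comp_of_integrable hf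
  calc ∫ ξ, f ξ ∂(stdGauss ι)
      = ∫ p, f (Function.update p.2 i p.1) ∂((gaussianReal 0 1).prod (stdGauss ι)) := by
        conv_lhs => rw [← hmp.map_eq]
        rw [integral_map hmp.measurable.aemeasurable (by rw [hmp.map_eq]; exact hf.1)]
    _ = _ := integral_prod_symm _ h1

lemma integrable_eval_stdGauss {ι : Type*} [Fintype ι] (i : ι) :
    Integrable (fun ξ : ι → ℝ => ξ i) (stdGauss ι) := by
  have h : Integrable (fun x : ℝ => x) (gaussianReal 0 1) :=
    (memLp_id_gaussianReal 1).integrable le_rfl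
  exact (measurePreserving_eval (fun _ : ι => gaussianReal 0 1) i).integrable_comp_of_integrable h

lemma fderiv_single_le {ι : Type*} [Fintype ι] [DecidableEq ι] {F : (ι → ℝ) → ℝ} {C : ℝ}
    (hF : ∀ ξ, ‖fderiv ℝ F ξ‖ ≤ C) (i : ι) (ξ : ι → ℝ) :
    |fderiv ℝ F ξ (Pi.single i 1)| ≤ C := by
  refine ((fderiv ℝ F ξ).le_opNorm _).trans ?_
  rw [Pi.norm_single]
  simpa using hF ξ

/-- Gaussian integration by parts on `ι → ℝ`. -/
lemma integral_eval_mul_stdGauss {ι : Type*} [Fintype ι] [DecidableEq ι] {F : (ι → ℝ) → ℝ} {C : ℝ}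
    (hF : ContDiff ℝ 1 F) (hC : ∀ ξ, |F ξ| ≤ C) (hC' : ∀ ξ, ‖fderiv ℝ F ξ‖ ≤ C) (i : ι) :
    ∫ ξ, ξ i * F ξ ∂(stdGauss ι) = ∫ ξ, fderiv ℝ F ξ (Pi.single i 1) ∂(stdGauss ι) := by
  have hcont : Continuous fun ξ => fderiv ℝ F ξ (Pi.single i 1) :=
    (hF.continuous_fderiv one_ne_zero).clm_apply continuous_const
  have hint1 : Integrable (fun ξ : ι → ℝ => ξ i * F ξ) (stdGauss ι) :=
    (integrable_eval_stdGauss i).mul_bdd (c := C) hF.continuous.aestronglyMeasurable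
      (Filter.Eventually.of_forall hC)
  have hint2 : Integrable (fun ξ : ι → ℝ => fderiv ℝ F ξ (Pi.single i 1)) (stdGauss ι) :=
    Integrable.of_bound hcont.aestronglyMeasurable C
      (Filter.Eventually.of_forall fun ξ => fderiv_single_le hC' i ξ)
  rw [integral_stdGauss_eq_integral_update hint1 i, integral_stdGauss_eq_integral_update hint2 i]
  refine integral_congr_ae (Filter.Eventually.of_forall fun ξ => ?_)
  simp only [Function.update_self]
  refine integral_mul_gaussianReal_std (C := C) (fun x => ?_) (fun x => hC _)
    (fun x => fderiv_single_le hC' i _) (hcont.comp (continuous_const.update i continuous_id))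
  have hd := (hF.differentiable one_ne_zero (Function.update ξ i x)).hasFDerivAt
  exact hd.comp_hasDerivAt x (hasDerivAt_update ξ i x)

/-- `C¹` functions that are bounded together with their derivative. -/
def BddC1 {E : Type*} [NormedAddCommGroup E] [NormedSpace ℝ E] (F : E → ℝ) : Prop :=
  ContDiff ℝ 1 F ∧ ∃ K, ∀ w, |F w| ≤ K ∧ ‖fderiv ℝ F w‖ ≤ K

section BddC1

variable {E E' : Type*} [NormedAddCommGroup E] [NormedSpace ℝ E]
  [NormedAddCommGroup E'] [NormedSpace ℝ E']

lemma bddC1_const (c : ℝ) : BddC1 (fun _ : E => c) :=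
  ⟨contDiff_const, |c|, fun w => ⟨le_rfl, by simp⟩⟩

lemma BddC1.neg {F : E → ℝ} (hF : BddC1 F) : BddC1 (fun w => -F w) := by
  obtain ⟨h, K, hK⟩ := hF
  exact ⟨h.neg, K, fun w => ⟨by simpa using (hK w).1, by simpa using (hK w).2⟩⟩

lemma BddC1.const_sub {F : E → ℝ} (hF : BddC1 F) (c : ℝ) : BddC1 (fun w => c - F w) := by
  obtain ⟨h, K, hK⟩ := hF
  refine ⟨contDiff_const.sub h, |c| + K, fun w => ⟨?_, ?_⟩⟩
  · exact (abs_sub _ _).trans (add_le_add le_rfl (hK w).1)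
  · rw [fderiv_const_sub, norm_neg]
    exact (hK w).2.trans (le_add_of_nonneg_left (abs_nonneg c))

lemma BddC1.mul {F G : E → ℝ} (hF : BddC1 F) (hG : BddC1 G) : BddC1 (fun w => F w * G w) := by
  obtain ⟨h, K, hK⟩ := hF
  obtain ⟨h', K', hK'⟩ := hG
  have hK0 : 0 ≤ K := (abs_nonneg _).trans (hK 0).1
  have hK0' : 0 ≤ K' := (abs_nonneg _).trans (hK' 0).1
  refine ⟨h.mul h', K * K' + K' * K, fun w => ⟨?_, ?_⟩⟩
  · rw [abs_mul]
    have := mul_le_mul (hK w).1 (hK' w).1 (abs_nonneg _) hK0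
    nlinarith [mul_nonneg hK0 hK0']
  · rw [fderiv_fun_mul (h.differentiable one_ne_zero w) (h'.differentiable one_ne_zero w)]
    refine (norm_add_le _ _).trans (add_le_add ?_ ?_)
    · rw [norm_smul]
      exact mul_le_mul (hK w).1 (hK' w).2 (norm_nonneg _) hK0
    · rw [norm_smul]
      exact mul_le_mul (hK' w).1 (hK w).2 (norm_nonneg _) hK0'

lemma BddC1.prod {ι : Type*} (s : Finset ι) {F : ι → E → ℝ} (hF : ∀ i, BddC1 (F i)) :
    BddC1 (fun w => ∏ i ∈ s, F i w) := by
  classical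
  induction s using Finset.induction_on with
  | empty => simpa using bddC1_const (E := E) 1
  | insert a s ha ih =>
    simp only [Finset.prod_insert ha]
    exact (hF a).mul ih

lemma BddC1.comp_clm {F : E → ℝ} (hF : BddC1 F) (L : E' →L[ℝ] E) : BddC1 (fun w => F (L w)) := by
  obtain ⟨h, K, hK⟩ := hF
  have hK0 : 0 ≤ K := (abs_nonneg _).trans (hK 0).1
  refine ⟨h.comp L.contDiff, max K (K * ‖L‖), fun w => ⟨(hK _).1.trans (le_max_left _ _), ?_⟩⟩
  have : fderiv ℝ (fun w => F (L w)) w = (fderiv ℝ F (L w)).comp L :=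
    ((h.differentiable one_ne_zero (L w)).hasFDerivAt.comp w L.hasFDerivAt).fderiv
  rw [this]
  refine (ContinuousLinearMap.opNorm_comp_le _ _).trans (le_trans ?_ (le_max_right _ _))
  exact mul_le_mul_of_nonneg_right (hK _).2 (norm_nonneg _)

end BddC1

/-- The linear map with coefficients `A`. -/
noncomputable def coeffMap {ι κ : Type*} [Fintype ι] (A : κ → ι → ℝ) : (ι → ℝ) →L[ℝ] (κ → ℝ) :=
  ContinuousLinearMap.pi fun k => ∑ i, A k i • ContinuousLinearMap.proj i

@[simp] lemma coeffMap_apply {ι κ : Type*} [Fintype ι] (A : κ → ι → ℝ) (ξ : ι → ℝ)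
    (k : κ) : coeffMap A ξ k = ∑ i, A k i * ξ i := by
  simp [coeffMap]

lemma integral_eval_mul_comp_coeffMap {ι κ : Type*} [Fintype ι] [Fintype κ] [DecidableEq ι]
    [DecidableEq κ] {F : (κ → ℝ) → ℝ} (hF : BddC1 F) (A : κ → ι → ℝ) (i : ι) :
    ∫ ξ, ξ i * F (coeffMap A ξ) ∂(stdGauss ι)
      = ∑ l, A l i * ∫ ξ, fderiv ℝ F (coeffMap A ξ) (Pi.single l 1) ∂(stdGauss ι) := by
  obtain ⟨h, K, hK⟩ := hF.comp_clm (coeffMap A)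
  obtain ⟨h', K', hK'⟩ := hF
  rw [integral_eval_mul_stdGauss (C := K) h (fun w => (hK w).1) (fun w => (hK w).2) i]
  simp_rw [← integral_const_mul]
  rw [← integral_finsetSum]
  · refine integral_congr_ae (Filter.Eventually.of_forall fun ξ => ?_)
    have e : fderiv ℝ (fun w => F (coeffMap A w)) ξ = (fderiv ℝ F (coeffMap A ξ)).comp (coeffMap A) :=
      ((h'.differentiable one_ne_zero _).hasFDerivAt.comp ξ (coeffMap A).hasFDerivAt).fderiv
    simp only [e, ContinuousLinearMap.comp_apply]
    have e2 : coeffMap A (Pi.single i 1) = ∑ l, A l i • (Pi.single l (1 : ℝ) : κ → ℝ) := by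
      ext k
      simp [Finset.sum_apply, Pi.single_apply]
    rw [e2, map_sum]
    simp
  · intro l _
    refine (Integrable.of_bound (C := K') ?_ ?_).const_mul _
    · exact (((h'.continuous_fderiv one_ne_zero).comp (coeffMap A).continuous).clm_apply
        continuous_const).aestronglyMeasurable
    · exact Filter.Eventually.of_forall fun ξ => fderiv_single_le (fun w => (hK' w).2) l _

/-- Interpolation inequality between two Gaussian vectors with disjointly supported coefficients. -/
theorem integral_comp_coeffMap_le {ι κ : Type*} [Fintype ι] [Fintype κ] [DecidableEq ι]
    [DecidableEq κ] {f : (κ → ℝ) → ℝ} {f1 : κ → (κ → ℝ) → ℝ} {K : ℝ}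
    (hf : ∀ w, HasFDerivAt f (∑ k, f1 k w • ContinuousLinearMap.proj (R := ℝ) (φ := fun _ => ℝ) k) w)
    (hK : ∀ w, |f w| ≤ K) (hf1 : ∀ k, BddC1 (f1 k)) {B C : κ → ι → ℝ}
    (hBC : ∀ k l i, B k i * C l i = 0)
    (hsign : ∀ k l w, 0 ≤ (∑ i, B k i * B l i - ∑ i, C k i * C l i) *
      fderiv ℝ (f1 k) w (Pi.single l 1)) :
    ∫ ξ, f (coeffMap C ξ) ∂(stdGauss ι) ≤ ∫ ξ, f (coeffMap B ξ) ∂(stdGauss ι) := by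
  set A : ℝ → κ → ι → ℝ := fun θ k i => sin θ * B k i + cos θ * C k i with hA
  set A' : ℝ → κ → ι → ℝ := fun θ k i => cos θ * B k i - sin θ * C k i with hA'
  choose K1 hK1 using fun k => (hf1 k).2
  have hK1n : ∀ k, 0 ≤ K1 k := fun k => (abs_nonneg _).trans (hK1 k 0).1
  have hfc : Continuous f := continuous_iff_continuousAt.2 fun w => (hf w).continuousAt
  have hcurve : ∀ θ ξ, HasDerivAt (fun t => coeffMap (A t) ξ) (coeffMap (A' θ) ξ) θ := by
    intro θ ξ
    refine hasDerivAt_pi.2 fun k => ?_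
    simp only [coeffMap_apply]
    refine HasDerivAt.fun_sum fun i _ => ?_
    have := (((hasDerivAt_sin θ).mul_const (B k i)).add
      ((hasDerivAt_cos θ).mul_const (C k i))).mul_const (ξ i)
    refine this.congr_deriv ?_
    simp only [hA']; ring
  have hder : ∀ θ ξ, HasDerivAt (fun t => f (coeffMap (A t) ξ))
      (∑ k, f1 k (coeffMap (A θ) ξ) * ∑ i, A' θ k i * ξ i) θ := by
    intro θ ξ
    refine ((hf _).comp_hasDerivAt θ (hcurve θ ξ)).congr_deriv ?_
    simp
  have hintg : ∀ θ k i, Integrable (fun ξ : ι → ℝ => ξ i * f1 k (coeffMap (A θ) ξ)) (stdGauss ι) :=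
    fun θ k i => (integrable_eval_stdGauss i).mul_bdd (c := K1 k)
      ((hf1 k).1.continuous.comp (coeffMap (A θ)).continuous).aestronglyMeasurable
      (Filter.Eventually.of_forall fun ξ => (hK1 k _).1)
  have hd : ∀ θ, HasDerivAt (fun t => ∫ ξ, f (coeffMap (A t) ξ) ∂(stdGauss ι))
      (∫ ξ, ∑ k, f1 k (coeffMap (A θ) ξ) * ∑ i, A' θ k i * ξ i ∂(stdGauss ι)) θ := by
    intro θ
    refine (hasDerivAt_integral_of_dominated_loc_of_deriv_le (𝕜 := ℝ) (s := Set.univ)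
      (F := fun t ξ => f (coeffMap (A t) ξ))
      (F' := fun t ξ => ∑ k, f1 k (coeffMap (A t) ξ) * ∑ i, A' t k i * ξ i)
      (bound := fun ξ : ι → ℝ => ∑ k, K1 k * ∑ i, (|B k i| + |C k i|) * |ξ i|)
      Filter.univ_mem ?_ ?_ ?_ ?_ ?_ ?_).2
    · exact Filter.Eventually.of_forall fun t =>
        (hfc.comp (coeffMap (A t)).continuous).aestronglyMeasurable
    · exact Integrable.of_bound (hfc.comp (coeffMap (A θ)).continuous).aestronglyMeasurable K
        (Filter.Eventually.of_forall fun ξ => hK _)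
    · refine Continuous.aestronglyMeasurable ?_
      refine continuous_finsetSum _ fun k _ => ?_
      exact ((hf1 k).1.continuous.comp (coeffMap (A θ)).continuous).mul (by fun_prop)
    · refine Filter.Eventually.of_forall fun ξ t _ => ?_
      refine (norm_sum_le _ _).trans (Finset.sum_le_sum fun k _ => ?_)
      rw [norm_mul]
      refine mul_le_mul (hK1 k _).1 ?_ (norm_nonneg _) (hK1n k)
      refine (norm_sum_le _ _).trans (Finset.sum_le_sum fun i _ => ?_)
      rw [norm_mul]
      refine mul_le_mul_of_nonneg_right ?_ (norm_nonneg _)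
      simp only [hA', Real.norm_eq_abs]
      refine (abs_sub _ _).trans (add_le_add ?_ ?_)
      · rw [abs_mul]
        exact mul_le_of_le_one_left (abs_nonneg _) (abs_cos_le_one t)
      · rw [abs_mul]
        exact mul_le_of_le_one_left (abs_nonneg _) (abs_sin_le_one t)
    · refine integrable_finsetSum _ fun k _ => Integrable.const_mul ?_ _
      exact integrable_finsetSum _ fun i _ => (integrable_eval_stdGauss i).abs.const_mul _
    · exact Filter.Eventually.of_forall fun ξ t _ => hder t ξ
  have hval : ∀ θ, ∫ ξ, ∑ k, f1 k (coeffMap (A θ) ξ) * ∑ i, A' θ k i * ξ i ∂(stdGauss ι)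
      = sin θ * cos θ * ∑ k, ∑ l, ∫ ξ, (∑ i, B k i * B l i - ∑ i, C k i * C l i) *
          fderiv ℝ (f1 k) (coeffMap (A θ) ξ) (Pi.single l 1) ∂(stdGauss ι) := by
    intro θ
    have e1 : ∀ ξ : ι → ℝ, ∑ k, f1 k (coeffMap (A θ) ξ) * ∑ i, A' θ k i * ξ i
        = ∑ k, ∑ i, A' θ k i * (ξ i * f1 k (coeffMap (A θ) ξ)) := by
      intro ξ
      refine Finset.sum_congr rfl fun k _ => ?_
      rw [Finset.mul_sum]
      exact Finset.sum_congr rfl fun i _ => by ring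
    simp_rw [e1]
    rw [integral_finsetSum _ fun k _ => integrable_finsetSum _ fun i _ => (hintg θ k i).const_mul _,
      Finset.mul_sum]
    refine Finset.sum_congr rfl fun k _ => ?_
    rw [integral_finsetSum _ fun i _ => (hintg θ k i).const_mul _, Finset.mul_sum]
    simp_rw [integral_const_mul, integral_eval_mul_comp_coeffMap (hf1 k) (A θ), Finset.mul_sum]
    rw [Finset.sum_comm]
    refine Finset.sum_congr rfl fun l _ => ?_
    rw [← Finset.sum_sub_distrib, Finset.sum_mul, Finset.mul_sum]
    refine Finset.sum_congr rfl fun i _ => ?_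
    have h1 := hBC k l i
    have h2 := hBC l k i
    simp only [hA, hA']
    linear_combination (∫ ξ, fderiv ℝ (f1 k) (coeffMap (A θ) ξ) (Pi.single l 1) ∂(stdGauss ι)) *
      (cos θ ^ 2 * h1 - sin θ ^ 2 * h2)
  have hmono : MonotoneOn (fun t => ∫ ξ, f (coeffMap (A t) ξ) ∂(stdGauss ι)) (Set.Icc 0 (π / 2)) := by
    refine monotoneOn_of_deriv_nonneg (convex_Icc _ _)
      (fun t _ => (hd t).continuousAt.continuousWithinAt)
      (fun t _ => (hd t).differentiableAt.differentiableWithinAt) fun t ht => ?_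
    rw [interior_Icc] at ht
    rw [(hd t).deriv, hval]
    refine mul_nonneg (mul_nonneg ?_ ?_) ?_
    · exact sin_nonneg_of_nonneg_of_le_pi ht.1.le (by linarith [ht.2, pi_pos])
    · exact cos_nonneg_of_mem_Icc ⟨by linarith [ht.1, pi_pos], ht.2.le⟩
    · exact Finset.sum_nonneg fun k _ => Finset.sum_nonneg fun l _ =>
        integral_nonneg fun ξ => hsign k l _
  have h0 : A 0 = C := by ext; simp [hA]
  have h1 : A (π / 2) = B := by ext; simp [hA]
  have := hmono ⟨le_rfl, by positivity⟩ ⟨by positivity, le_rfl⟩ (by positivity : (0 : ℝ) ≤ π / 2)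
  simpa only [h0, h1] using this

lemma bddC1_of_eventually_const {F : ℝ → ℝ} {a b c d : ℝ} (hF : ContDiff ℝ 1 F)
    (hl : ∀ x < a, F x = c) (hr : ∀ x, b < x → F x = d) : BddC1 F := by
  obtain ⟨K1, hK1⟩ := isCompact_Icc.exists_bound_of_continuousOn
    (s := Set.Icc a b) hF.continuous.continuousOn
  obtain ⟨K2, hK2⟩ := isCompact_Icc.exists_bound_of_continuousOn
    (s := Set.Icc a b) (hF.continuous_fderiv one_ne_zero).continuousOn
  refine ⟨hF, max (max |K1| |K2|) (max |c| |d|), fun x => ?_⟩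
  rcases lt_or_ge x a with h | h
  · have e : F =ᶠ[nhds x] fun _ => c := (gt_mem_nhds h).mono fun y hy => hl y hy
    refine ⟨by rw [hl x h]; simp, ?_⟩
    rw [e.fderiv_eq]
    simp
  rcases lt_or_ge b x with h' | h'
  · have e : F =ᶠ[nhds x] fun _ => d := (lt_mem_nhds h').mono fun y hy => hr y hy
    refine ⟨by rw [hr x h']; simp, ?_⟩
    rw [e.fderiv_eq]
    simp
  · refine ⟨(hK1 x ⟨h, h'⟩).trans ((le_abs_self _).trans ?_),
      (hK2 x ⟨h, h'⟩).trans ((le_abs_self _).trans ?_)⟩ <;> simp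

/-- A smooth decreasing cutoff equal to one below `a` and to zero above `a + η`. -/
noncomputable def smoothStep (η a x : ℝ) : ℝ := 1 - smoothTransition ((x - a) / η)

section smoothStep

variable {η : ℝ} (a : ℝ)

lemma smoothStep_contDiff : ContDiff ℝ 2 (smoothStep η a) :=
  contDiff_const.sub (smoothTransition.contDiff.comp ((contDiff_id.sub contDiff_const).div_const η))

lemma smoothStep_nonneg (x : ℝ) : 0 ≤ smoothStep η a x :=
  sub_nonneg.2 (smoothTransition.le_one _)

lemma smoothStep_le_one (x : ℝ) : smoothStep η a x ≤ 1 :=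
  sub_le_self _ (smoothTransition.nonneg _)

lemma smoothStep_antitone (hη : 0 < η) : Antitone (smoothStep η a) := fun _ _ h =>
  sub_le_sub_left (smoothTransition.monotone
    (div_le_div_of_nonneg_right (sub_le_sub_right h a) hη.le)) 1

lemma smoothStep_of_le (hη : 0 < η) {x : ℝ} (hx : x ≤ a) : smoothStep η a x = 1 := by
  simp [smoothStep, smoothTransition.zero_of_nonpos (div_nonpos_of_nonpos_of_nonneg
    (sub_nonpos.2 hx) hη.le)]

lemma smoothStep_of_ge (hη : 0 < η) {x : ℝ} (hx : a + η ≤ x) : smoothStep η a x = 0 := by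
  have : 1 ≤ (x - a) / η := by rw [le_div_iff₀ hη]; linarith
  simp [smoothStep, smoothTransition.one_of_one_le this]

lemma smoothStep_bddC1 (hη : 0 < η) : BddC1 (smoothStep η a) :=
  bddC1_of_eventually_const ((smoothStep_contDiff a).of_le (by norm_num))
    (fun _ hx => smoothStep_of_le a hη hx.le) (fun _ hx => smoothStep_of_ge a hη (le_of_lt hx))

lemma deriv_smoothStep_bddC1 (hη : 0 < η) : BddC1 (deriv (smoothStep η a)) := by
  refine bddC1_of_eventually_const (a := a) (b := a + η) (c := 0) (d := 0) ?_ ?_ ?_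
  · exact ((contDiff_succ_iff_deriv (n := 1)).1 (smoothStep_contDiff a)).2.2
  · intro x hx
    have e : smoothStep η a =ᶠ[nhds x] fun _ => 1 :=
      (gt_mem_nhds hx).mono fun y hy => smoothStep_of_le a hη (le_of_lt hy)
    rw [e.deriv_eq]; simp
  · intro x hx
    have e : smoothStep η a =ᶠ[nhds x] fun _ => 0 :=
      (lt_mem_nhds hx).mono fun y hy => smoothStep_of_ge a hη (le_of_lt hy)
    rw [e.deriv_eq]; simp

end smoothStep

lemma fderiv_nonneg_of_monotone {E : Type*} [NormedAddCommGroup E] [NormedSpace ℝ E] {F : E → ℝ}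
    {w v : E} (hF : DifferentiableAt ℝ F w) (h : Monotone fun t : ℝ => F (w + t • v)) :
    0 ≤ fderiv ℝ F w v := by
  have h1 : HasDerivAt (fun t : ℝ => w + t • v) v 0 := by
    simpa using ((hasDerivAt_id (0 : ℝ)).smul_const v).const_add w
  have h2 : HasDerivAt (fun t : ℝ => F (w + t • v)) (fderiv ℝ F w v) 0 := by
    have hF' : HasFDerivAt F (fderiv ℝ F w) (w + (0 : ℝ) • v) := by
      simpa using hF.hasFDerivAt
    exact hF'.comp_hasDerivAt 0 h1
  rw [← h2.deriv]
  exact h.deriv_nonneg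

/-- Finite form of Gordon's comparison inequality. -/
theorem gordon_finite {ι J K : Type*} [Fintype ι] [Fintype J] [Fintype K]
    {B C : J × K → ι → ℝ} (hBC : ∀ k l i, B k i * C l i = 0)
    (heq : ∀ j k k', ∑ i, B (j, k) i * B (j, k') i = ∑ i, C (j, k) i * C (j, k') i)
    (hle : ∀ p q, ∑ i, C p i * C q i ≤ ∑ i, B p i * B q i)
    (l : J × K → ℝ) {η : ℝ} (hη : 0 < η) :
    stdGauss ι {ξ | ∃ j, ∀ k, coeffMap B ξ (j, k) ≤ l (j, k)} ≤
      stdGauss ι {ξ | ∃ j, ∀ k, coeffMap C ξ (j, k) ≤ l (j, k) + η} := by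
  classical
  set S : J × K → ℝ → ℝ := fun p => smoothStep η (l p) with hS
  set Q : J → (J × K → ℝ) → ℝ := fun j w => ∏ k, S (j, k) (w (j, k)) with hQ
  set f : (J × K → ℝ) → ℝ := fun w => ∏ j, (1 - Q j w) with hf
  set f1 : J × K → (J × K → ℝ) → ℝ := fun p w =>
    (∏ j ∈ Finset.univ.erase p.1, (1 - Q j w)) *
      ((∏ k ∈ Finset.univ.erase p.2, S (p.1, k) (w (p.1, k))) * -deriv (S p) (w p)) with hf1
  have hS01 : ∀ p x, 0 ≤ S p x ∧ S p x ≤ 1 := fun p x =>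
    ⟨smoothStep_nonneg _ x, smoothStep_le_one _ x⟩
  have hQ01 : ∀ j w, 0 ≤ Q j w ∧ Q j w ≤ 1 := fun j w =>
    ⟨Finset.prod_nonneg fun k _ => (hS01 _ _).1,
      Finset.prod_le_one (fun k _ => (hS01 _ _).1) fun k _ => (hS01 _ _).2⟩
  have hf01 : ∀ w, 0 ≤ f w ∧ f w ≤ 1 := fun w =>
    ⟨Finset.prod_nonneg fun j _ => sub_nonneg.2 (hQ01 j w).2,
      Finset.prod_le_one (fun j _ => sub_nonneg.2 (hQ01 j w).2)
        fun j _ => sub_le_self _ (hQ01 j w).1⟩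
  have hSd : ∀ p x, HasDerivAt (S p) (deriv (S p) x) x := fun p x =>
    ((smoothStep_contDiff (l p)).differentiable (by norm_num) x).hasDerivAt
  have hcoord : ∀ (p : J × K) (w : J × K → ℝ), HasFDerivAt (fun w : J × K → ℝ => w p)
      (ContinuousLinearMap.proj (R := ℝ) (φ := fun _ => ℝ) p) w := fun p w =>
    (ContinuousLinearMap.proj (R := ℝ) (φ := fun _ => ℝ) p).hasFDerivAt
  have hfd : ∀ w, HasFDerivAt f
      (∑ p, f1 p w • ContinuousLinearMap.proj (R := ℝ) (φ := fun _ => ℝ) p) w := by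
    intro w
    have hQd : ∀ j, HasFDerivAt (fun w => 1 - Q j w)
        (-∑ k, (∏ k' ∈ Finset.univ.erase k, S (j, k') (w (j, k'))) •
          deriv (S (j, k)) (w (j, k)) •
            ContinuousLinearMap.proj (R := ℝ) (φ := fun _ => ℝ) (j, k)) w := fun j =>
      (HasFDerivAt.finsetProd fun k _ =>
        (hSd (j, k) (w (j, k))).comp_hasFDerivAt w (hcoord (j, k) w)).const_sub 1
    refine (HasFDerivAt.finsetProd fun j _ => hQd j).congr_fderiv ?_
    rw [Fintype.sum_prod_type]
    refine Finset.sum_congr rfl fun j _ => ?_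
    rw [← Finset.sum_neg_distrib, Finset.smul_sum]
    refine Finset.sum_congr rfl fun k _ => ?_
    ext v
    simp [hf1]
    ring
  have hSb : ∀ p, BddC1 fun w : J × K → ℝ => S p (w p) := fun p =>
    (smoothStep_bddC1 (l p) hη).comp_clm (ContinuousLinearMap.proj (R := ℝ) (φ := fun _ => ℝ) p)
  have hSb' : ∀ p, BddC1 fun w : J × K → ℝ => deriv (S p) (w p) := fun p =>
    (deriv_smoothStep_bddC1 (l p) hη).comp_clm
      (ContinuousLinearMap.proj (R := ℝ) (φ := fun _ => ℝ) p)
  have hf1b : ∀ p, BddC1 (f1 p) := fun p =>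
    (BddC1.prod _ fun j => (BddC1.prod _ fun k => hSb (j, k)).const_sub 1).mul
      ((BddC1.prod _ fun k => hSb (p.1, k)).mul (hSb' p).neg)
  have hmono : ∀ p q : J × K, p.1 ≠ q.1 → ∀ w : J × K → ℝ,
      Monotone fun t : ℝ => f1 p (w + t • Pi.single q 1) := by
    intro p q hpq w s t hst
    have hne : ∀ k, (p.1, k) ≠ q := fun k h => hpq (by rw [← h])
    have hfix : ∀ (t : ℝ) k, (w + t • (Pi.single q 1 : J × K → ℝ)) (p.1, k) = w (p.1, k) := by
      intro t k
      simp [hne k]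
    simp only [hf1, hfix]
    refine mul_le_mul_of_nonneg_right ?_ ?_
    · refine Finset.prod_le_prod (fun j _ => sub_nonneg.2 (hQ01 j _).2) fun j _ => ?_
      refine sub_le_sub_left (Finset.prod_le_prod (fun k _ => (hS01 _ _).1) fun k _ => ?_) 1
      refine smoothStep_antitone _ hη ?_
      simp only [Pi.add_apply, Pi.smul_apply, Pi.single_apply, smul_eq_mul]
      split_ifs
      · simpa using hst
      · simp
    · refine mul_nonneg (Finset.prod_nonneg fun k _ => (hS01 _ _).1) ?_
      exact neg_nonneg.2 ((smoothStep_antitone (l p) hη).deriv_nonpos)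
  have key := integral_comp_coeffMap_le hfd (K := 1)
    (fun w => by rw [abs_of_nonneg (hf01 w).1]; exact (hf01 w).2) hf1b hBC (by
      intro p q w
      by_cases h : p.1 = q.1
      · obtain ⟨j, k⟩ := p
        obtain ⟨j', k'⟩ := q
        obtain rfl : j = j' := h
        rw [heq, sub_self, zero_mul]
      · exact mul_nonneg (sub_nonneg.2 (hle p q))
          (fderiv_nonneg_of_monotone ((hf1b p).1.differentiable one_ne_zero w) (hmono p q h w)))
  have hfc : Continuous f := continuous_iff_continuousAt.2 fun w => (hfd w).continuousAt
  have hintg : ∀ D : J × K → ι → ℝ, Integrable (fun ξ => f (coeffMap D ξ)) (stdGauss ι) := fun D =>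
    Integrable.of_bound (hfc.comp (coeffMap D).continuous).aestronglyMeasurable 1
      (Filter.Eventually.of_forall fun ξ => by
        rw [Real.norm_eq_abs, abs_of_nonneg (hf01 _).1]; exact (hf01 _).2)
  have hmeas : ∀ (D : J × K → ι → ℝ) (c : J × K → ℝ),
      MeasurableSet {ξ : ι → ℝ | ∃ j, ∀ k, coeffMap D ξ (j, k) ≤ c (j, k)} := by
    intro D c
    simp only [Set.ofPred_exists, Set.ofPred_forall]
    refine MeasurableSet.iUnion fun j => MeasurableSet.iInter fun k => ?_
    exact measurableSet_le ((measurable_pi_apply _).comp (coeffMap D).measurable) measurable_const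
  have hB : (stdGauss ι).real {ξ | ∃ j, ∀ k, coeffMap B ξ (j, k) ≤ l (j, k)} ≤
      ∫ ξ, (1 - f (coeffMap B ξ)) ∂(stdGauss ι) := by
    rw [← integral_indicator_one (hmeas B l)]
    refine integral_mono ((integrable_const (1 : ℝ)).indicator (hmeas B l))
      ((integrable_const 1).sub (hintg B)) fun ξ => ?_
    simp only [Set.indicator_apply, Pi.one_apply]
    split_ifs with h
    · obtain ⟨j, hj⟩ := h
      have : f (coeffMap B ξ) = 0 := by
        refine Finset.prod_eq_zero (Finset.mem_univ j) (sub_eq_zero.2 ?_)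
        exact (Finset.prod_eq_one fun k _ => smoothStep_of_le _ hη (hj k)).symm
      rw [this, sub_zero]
    · exact sub_nonneg.2 (hf01 _).2
  have hC : ∫ ξ, (1 - f (coeffMap C ξ)) ∂(stdGauss ι) ≤
      (stdGauss ι).real {ξ | ∃ j, ∀ k, coeffMap C ξ (j, k) ≤ l (j, k) + η} := by
    rw [← integral_indicator_one (hmeas C fun p => l p + η)]
    refine integral_mono ((integrable_const 1).sub (hintg C))
      ((integrable_const (1 : ℝ)).indicator (hmeas C fun p => l p + η)) fun ξ => ?_
    simp only [Set.indicator_apply, Pi.one_apply]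
    split_ifs with h
    · exact sub_le_self _ (hf01 _).1
    · rw [Set.mem_ofPred_eq] at h
      push Not at h
      have : f (coeffMap C ξ) = 1 := by
        refine Finset.prod_eq_one fun j _ => ?_
        obtain ⟨k, hk⟩ := h j
        rw [sub_eq_self]
        exact Finset.prod_eq_zero (Finset.mem_univ k) (smoothStep_of_ge _ hη hk.le)
      rw [this, sub_self]
  have hfin := hB.trans (le_trans ?_ hC)
  · rwa [Measure.real, Measure.real, ENNReal.toReal_le_toReal (measure_ne_top _ _)
      (measure_ne_top _ _)] at hfin
  · rw [integral_sub (integrable_const _) (hintg B), integral_sub (integrable_const _) (hintg C)]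
    exact sub_le_sub_left key _

/-- Gordon's comparison inequality for countable families. -/
theorem gordon_countable {ι : Type*} [Fintype ι]
    {B C : ℕ × ℕ → ι → ℝ} (hBC : ∀ k l i, B k i * C l i = 0)
    (heq : ∀ j k k', ∑ i, B (j, k) i * B (j, k') i = ∑ i, C (j, k) i * C (j, k') i)
    (hle : ∀ p q, ∑ i, C p i * C q i ≤ ∑ i, B p i * B q i)
    (l : ℕ × ℕ → ℝ) {η : ℝ} (hη : 0 < η) :
    stdGauss ι {ξ | ∃ j, ∀ k, ∑ i, B (j, k) i * ξ i ≤ l (j, k)} ≤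
      stdGauss ι {ξ | ∃ j, ∀ k, ∑ i, C (j, k) i * ξ i ≤ l (j, k) + η} := by
  have hfin : ∀ N M : ℕ, stdGauss ι {ξ | ∃ j < N, ∀ k < M, ∑ i, B (j, k) i * ξ i ≤ l (j, k)} ≤
      stdGauss ι {ξ | ∃ j < N, ∀ k < M, ∑ i, C (j, k) i * ξ i ≤ l (j, k) + η} := by
    intro N M
    have := gordon_finite (J := Fin N) (K := Fin M) (B := fun p => B (p.1, p.2))
      (C := fun p => C (p.1, p.2)) (fun _ _ => hBC _ _) (fun _ _ _ => heq _ _ _)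
      (fun _ _ => hle _ _) (fun p => l (p.1, p.2)) hη
    simpa [Fin.exists_iff, Fin.forall_iff] using this
  have hmeas : ∀ (N M : ℕ), MeasurableSet
      {ξ : ι → ℝ | ∃ j < N, ∀ k < M, ∑ i, C (j, k) i * ξ i ≤ l (j, k) + η} := by
    intro N M
    simp only [Set.ofPred_exists, Set.ofPred_forall, Set.ofPred_and]
    refine MeasurableSet.iUnion fun j => (MeasurableSet.const _).inter
      (MeasurableSet.iInter fun k => MeasurableSet.iInter fun _ => ?_)
    exact measurableSet_le (by fun_prop) measurable_const
  have hstep : ∀ N : ℕ, stdGauss ι {ξ | ∃ j < N, ∀ k, ∑ i, B (j, k) i * ξ i ≤ l (j, k)} ≤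
      stdGauss ι {ξ | ∃ j, ∀ k, ∑ i, C (j, k) i * ξ i ≤ l (j, k) + η} := by
    intro N
    have ht := tendsto_measure_iInter_atTop (μ := stdGauss ι)
      (s := fun M => {ξ : ι → ℝ | ∃ j < N, ∀ k < M, ∑ i, C (j, k) i * ξ i ≤ l (j, k) + η})
      (fun M => (hmeas N M).nullMeasurableSet)
      (by
        intro M M' h ξ hξ
        obtain ⟨j, hj, hk⟩ := hξ
        exact ⟨j, hj, fun k hkM => hk k (hkM.trans_le h)⟩)
      ⟨0, measure_ne_top _ _⟩
    have hsub : (⋂ M, {ξ : ι → ℝ | ∃ j < N, ∀ k < M, ∑ i, C (j, k) i * ξ i ≤ l (j, k) + η}) ⊆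
        {ξ | ∃ j, ∀ k, ∑ i, C (j, k) i * ξ i ≤ l (j, k) + η} := by
      intro ξ hξ
      simp only [Set.mem_iInter, Set.mem_ofPred_eq] at hξ
      by_contra hcon
      simp only [Set.mem_ofPred_eq, not_exists, not_forall] at hcon
      choose k hk using hcon
      obtain ⟨j, hj, hjk⟩ := hξ ((Finset.range N).sup k + 1)
      exact hk j (hjk (k j) (Nat.lt_succ_of_le (Finset.le_sup (Finset.mem_range.2 hj))))
    refine le_trans (ge_of_tendsto' ht fun M => ?_) (measure_mono hsub)
    exact (measure_mono (by
      intro ξ hξ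
      obtain ⟨j, hj, hk⟩ := hξ
      exact ⟨j, hj, fun k _ => hk k⟩)).trans (hfin N M)
  have ht := tendsto_measure_iUnion_atTop (μ := stdGauss ι)
    (s := fun N => {ξ : ι → ℝ | ∃ j < N, ∀ k, ∑ i, B (j, k) i * ξ i ≤ l (j, k)})
    (by
      intro N N' h ξ hξ
      obtain ⟨j, hj, hk⟩ := hξ
      exact ⟨j, hj.trans_le h, hk⟩)
  refine le_trans (measure_mono ?_) (le_of_tendsto' ht hstep)
  rintro ξ ⟨j, hj⟩
  exact Set.mem_iUnion.2 ⟨j + 1, j, Nat.lt_succ_self j, hj⟩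

lemma integrable_exp_mul_of_lipschitz {F : ℝ → ℝ} {L : ℝ≥0} (hF : LipschitzWith L F) (t : ℝ) :
    Integrable (fun x => exp (t * F x)) (gaussianReal 0 1) := by
  have h : Integrable (fun x => exp (|t * F 0|) * exp (|t| * L * |x|)) (gaussianReal 0 1) :=
    (integrable_exp_mul_abs (integrable_exp_mul_gaussianReal _)
      (integrable_exp_mul_gaussianReal _)).const_mul _
  refine h.mono' (continuous_exp.comp (hF.continuous.const_mul t)).aestronglyMeasurable
    (Filter.Eventually.of_forall fun x => ?_)
  rw [Real.norm_eq_abs, abs_exp, ← exp_add, exp_le_exp]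
  have h1 : |F x - F 0| ≤ L * |x| := by simpa [Real.dist_eq] using hF.dist_le_mul x 0
  have h2 : |t * (F x - F 0)| ≤ |t| * L * |x| := by
    rw [abs_mul, mul_assoc]; exact mul_le_mul_of_nonneg_left h1 (abs_nonneg t)
  have h3 := le_abs_self (t * (F x - F 0))
  have h4 := le_abs_self (t * F 0)
  linarith

lemma integrable_of_lipschitz {F : ℝ → ℝ} {L : ℝ≥0} (hF : LipschitzWith L F) :
    Integrable F (gaussianReal 0 1) := by
  have hid : Integrable (fun x : ℝ => x) (gaussianReal 0 1) :=
    (memLp_id_gaussianReal 1).integrable le_rfl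
  refine ((integrable_const |F 0|).add (hid.abs.const_mul (L : ℝ))).mono'
    hF.continuous.aestronglyMeasurable (Filter.Eventually.of_forall fun x => ?_)
  have h1 : |F x - F 0| ≤ L * |x| := by simpa [Real.dist_eq] using hF.dist_le_mul x 0
  have h2 := abs_sub_abs_le_abs_sub (F x) (F 0)
  simp only [Real.norm_eq_abs, Pi.add_apply]
  linarith

/-- A Lipschitz function of a standard Gaussian variable is sub-Gaussian. -/
lemma hasSubgaussianMGF_of_lipschitz {F : ℝ → ℝ} {L : ℝ≥0} (hF : LipschitzWith L F) :
    HasSubgaussianMGF (fun x => F x - ∫ y, F y ∂(gaussianReal 0 1)) (2 * L ^ 2)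
      (gaussianReal 0 1) := by
  set μ := gaussianReal 0 1 with hμ
  set E := ∫ y, F y ∂μ with hE
  have hi := integrable_exp_mul_of_lipschitz hF
  have hsplit : ∀ t x, exp (t * (F x - E)) = exp (t * F x) * exp (-t * E) := fun t x => by
    rw [← exp_add]; ring_nf
  refine ⟨fun t => ?_, fun t => ?_⟩
  · simp only [hsplit]
    exact (hi t).mul_const _
  have hjensen : exp (-t * E) ≤ ∫ y, exp (-t * F y) ∂μ := by
    have := convexOn_exp.map_integral_le (μ := μ) (f := fun y => -t * F y)
      continuous_exp.continuousOn isClosed_univ (by simp)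
      ((integrable_of_lipschitz hF).const_mul _) (hi (-t))
    rwa [integral_const_mul] at this
  have hlin : ∀ t : ℝ, ∫ x, exp (t * x) ∂μ = exp (t ^ 2 / 2) := fun t => by
    have := mgf_gaussianReal (p := μ) (X := id) (μ := 0) (v := 1) (by simp [hμ]) t
    simpa [mgf] using this
  have hii : ∀ t : ℝ, Integrable (fun x => exp (t * x)) μ := fun t =>
    integrable_exp_mul_gaussianReal t
  have hprod : 2 * ((∫ x, exp (t * F x) ∂μ) * ∫ y, exp (-t * F y) ∂μ) ≤
      2 * exp (t ^ 2 * L ^ 2) := by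
    have e1 : 2 * ((∫ x, exp (t * F x) ∂μ) * ∫ y, exp (-t * F y) ∂μ) =
        ∫ p, (exp (t * F p.1) * exp (-t * F p.2) + exp (-t * F p.1) * exp (t * F p.2)) ∂(μ.prod μ) := by
      rw [integral_add ((hi t).mul_prod (hi (-t))) ((hi (-t)).mul_prod (hi t)),
        integral_prod_mul (fun x => exp (t * F x)) fun y => exp (-t * F y),
        integral_prod_mul (fun x => exp (-t * F x)) fun y => exp (t * F y)]
      ring
    have e2 : 2 * exp (t ^ 2 * L ^ 2) =
        ∫ p, (exp ((t * L) * p.1) * exp (-(t * L) * p.2) +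
          exp (-(t * L) * p.1) * exp ((t * L) * p.2)) ∂(μ.prod μ) := by
      rw [integral_add ((hii _).mul_prod (hii _)) ((hii _).mul_prod (hii _)),
        integral_prod_mul (fun x => exp (t * L * x)) fun y => exp (-(t * L) * y),
        integral_prod_mul (fun x => exp (-(t * L) * x)) fun y => exp (t * L * y), hlin, hlin,
        ← exp_add, ← exp_add]
      ring_nf
    rw [e1, e2]
    refine integral_mono (((hi t).mul_prod (hi (-t))).add ((hi (-t)).mul_prod (hi t)))
      (((hii _).mul_prod (hii _)).add ((hii _).mul_prod (hii _))) fun p => ?_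
    have hc : ∀ a b : ℝ, exp a * exp (-b) + exp (-a) * exp b = 2 * cosh (a - b) := fun a b => by
      rw [cosh_eq, ← exp_add, ← exp_add]; ring_nf
    have h1 : |F p.1 - F p.2| ≤ L * |p.1 - p.2| := by
      simpa [Real.dist_eq] using hF.dist_le_mul p.1 p.2
    simp only [neg_mul, hc]
    refine mul_le_mul_of_nonneg_left (cosh_le_cosh.2 ?_) zero_le_two
    rw [← mul_sub, ← mul_sub, abs_mul, abs_mul, abs_mul, NNReal.abs_eq, mul_assoc]
    exact mul_le_mul_of_nonneg_left h1 (abs_nonneg t)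
  calc mgf (fun x => F x - E) μ t = (∫ x, exp (t * F x) ∂μ) * exp (-t * E) := by
        simp only [mgf, hsplit, integral_mul_const]
    _ ≤ (∫ x, exp (t * F x) ∂μ) * ∫ y, exp (-t * F y) ∂μ :=
        mul_le_mul_of_nonneg_left hjensen (integral_nonneg fun _ => (exp_pos _).le)
    _ ≤ exp (t ^ 2 * L ^ 2) := by linarith
    _ = _ := by
      congr 1
      push_cast
      ring

lemma iIndepFun_comp_eval {ι κ : Type*} [Fintype ι] {e : κ → ι} (he : e.Injective)
    {F : κ → ℝ → ℝ} (hF : ∀ i, Measurable (F i)) :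
    iIndepFun (fun i (ξ : ι → ℝ) => F i (ξ (e i))) (stdGauss ι) :=
  ((iIndepFun_pi (μ := fun _ : ι => gaussianReal 0 1) (X := fun _ x => x)
    fun _ => aemeasurable_id).precomp he).comp _ hF

lemma identDistrib_comp_eval {ι : Type*} [Fintype ι] (i : ι) {F : ℝ → ℝ} (hF : Measurable F) :
    IdentDistrib F (fun ξ : ι → ℝ => F (ξ i)) (gaussianReal 0 1) (stdGauss ι) where
  aemeasurable_fst := hF.aemeasurable
  aemeasurable_snd := (hF.comp (measurable_pi_apply i)).aemeasurable
  map_eq := by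
    rw [← (measurePreserving_eval (fun _ : ι => gaussianReal 0 1) i).map_eq,
      Measure.map_map hF (measurable_pi_apply i)]
    rfl

/-- Two-sided tail bound for a sum of Lipschitz functions of independent Gaussians. -/
lemma measure_abs_sum_sub_integral_ge {ι : Type*} [Fintype ι] {k : ℕ} {e : Fin k → ι}
    (he : e.Injective) {F : Fin k → ℝ → ℝ} {L : ℝ≥0} (hF : ∀ i, LipschitzWith L (F i))
    {a : ℝ} (ha : 0 ≤ a) :
    (stdGauss ι).real {ξ | a ≤ |∑ i, (F i (ξ (e i)) - ∫ x, F i x ∂(gaussianReal 0 1))|} ≤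
      2 * exp (-a ^ 2 / (4 * k * L ^ 2)) := by
  have key : ∀ G : Fin k → ℝ → ℝ, (∀ i, LipschitzWith L (G i)) →
      (stdGauss ι).real {ξ | a ≤ ∑ i, (G i (ξ (e i)) - ∫ x, G i x ∂(gaussianReal 0 1))} ≤
        exp (-a ^ 2 / (4 * k * L ^ 2)) := by
    intro G hG
    have hm : ∀ i, Measurable fun x => G i x - ∫ x, G i x ∂(gaussianReal 0 1) := fun i =>
      (hG i).continuous.measurable.sub_const _
    have := HasSubgaussianMGF.measure_sum_ge_le_of_iIndepFun (iIndepFun_comp_eval he hm)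
      (s := Finset.univ) (c := fun _ => 2 * L ^ 2) (fun i _ =>
        (hasSubgaussianMGF_of_lipschitz (hG i)).congr_identDistrib
          (identDistrib_comp_eval (e i) (hm i))) ha
    refine this.trans_eq ?_
    congr 2
    simp
    ring
  have h1 := key F hF
  have h2 := key (fun i x => -F i x) fun i => (hF i).neg
  have hsub : {ξ : ι → ℝ | a ≤ |∑ i, (F i (ξ (e i)) - ∫ x, F i x ∂(gaussianReal 0 1))|} ⊆
      {ξ | a ≤ ∑ i, (F i (ξ (e i)) - ∫ x, F i x ∂(gaussianReal 0 1))} ∪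
      {ξ | a ≤ ∑ i, (-F i (ξ (e i)) - ∫ x, -F i x ∂(gaussianReal 0 1))} := by
    intro ξ hξ
    rcases le_abs.1 (show a ≤ |_| from hξ) with h | h
    · exact Or.inl h
    · refine Or.inr (h.trans_eq ?_)
      rw [← Finset.sum_neg_distrib]
      refine Finset.sum_congr rfl fun i _ => ?_
      rw [integral_neg]
      ring
  refine (measureReal_mono hsub).trans ((measureReal_union_le _ _).trans ?_)
  linarith

lemma mgf_sq_sub_one_le {t : ℝ} (ht : |t| ≤ 1 / 4) :
    mgf (fun x => x ^ 2 - 1) (gaussianReal 0 1) t ≤ exp (4 * t ^ 2) := by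
  have h1 : 0 < 1 - 2 * t := by linarith [(abs_le.1 ht).2]
  have e : mgf (fun x => x ^ 2 - 1) (gaussianReal 0 1) t = exp (-t) * (√(1 - 2 * t))⁻¹ := by
    rw [mgf, integral_gaussianReal_eq_integral_smul one_ne_zero]
    have : ∀ x : ℝ, gaussianPDFReal 0 1 x • exp (t * (x ^ 2 - 1)) =
        (exp (-t) * (√(2 * π))⁻¹) * exp (-((1 - 2 * t) / 2) * x ^ 2) := fun x => by
      simp only [gaussianPDFReal, smul_eq_mul, NNReal.coe_one, mul_one, sub_zero]
      rw [mul_assoc, ← exp_add, mul_right_comm, ← exp_add, mul_comm]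
      ring_nf
    simp only [this]
    rw [integral_const_mul, integral_gaussian, mul_assoc, ← sqrt_inv, ← sqrt_mul (by positivity),
      ← sqrt_inv]
    congr 2
    field_simp
  rw [e, ← log_le_iff_le_exp (by positivity), log_mul (exp_pos _).ne' (by positivity), log_exp,
    log_inv, log_sqrt h1.le]
  have h2 := one_sub_inv_le_log_of_pos h1
  have h3 : 1 - (1 - 2 * t)⁻¹ ≥ -(2 * t) - 8 * t ^ 2 := by
    have h4 : (1 - 2 * t)⁻¹ ≤ 1 + 2 * t + 8 * t ^ 2 := by
      rw [inv_le_iff_one_le_mul₀ h1]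
      have := (abs_le.1 ht).2
      nlinarith [mul_nonneg (sq_nonneg t) (by linarith : (0 : ℝ) ≤ 4 - 16 * t)]
    linarith
  linarith

lemma integrable_exp_sq {t : ℝ} (ht : |t| ≤ 1 / 4) :
    Integrable (fun x : ℝ => exp (t * (x ^ 2 - 1))) (gaussianReal 0 1) := by
  have h1 : 0 < (1 - 2 * t) / 2 := by linarith [(abs_le.1 ht).2]
  rw [gaussianReal_of_var_ne_zero _ one_ne_zero,
    integrable_withDensity_iff_integrable_smul' (by fun_prop) (by simp [gaussianPDF])]
  refine ((integrable_exp_neg_mul_sq h1).const_mul (exp (-t) * (√(2 * π))⁻¹)).congr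
    (Filter.Eventually.of_forall fun x => ?_)
  simp only [toReal_gaussianPDF]
  simp only [gaussianPDFReal, smul_eq_mul, NNReal.coe_one, mul_one, sub_zero]
  rw [mul_assoc (√(2 * π))⁻¹, ← exp_add, mul_right_comm, ← exp_add, mul_comm]
  ring_nf

/-- Tail bound for a chi-squared variable. -/
lemma measure_abs_sum_sq_sub_ge {ι : Type*} [Fintype ι] {k : ℕ} {e : Fin k → ι}
    (he : e.Injective) {a t : ℝ} (ht : 0 ≤ t) (ht' : t ≤ 1 / 4) :
    (stdGauss ι).real {ξ | a ≤ |∑ i, (ξ (e i) ^ 2 - 1)|} ≤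
      2 * exp (-t * a + k * (4 * t ^ 2)) := by
  have hm : ∀ _ : Fin k, Measurable fun x : ℝ => x ^ 2 - 1 := fun i => by fun_prop
  have hind := iIndepFun_comp_eval he hm
  have hmeas : ∀ i : Fin k, Measurable fun ξ : ι → ℝ => ξ (e i) ^ 2 - 1 := fun i => by fun_prop
  have hmgf : ∀ t : ℝ, |t| ≤ 1 / 4 →
      mgf (∑ i, fun ξ : ι → ℝ => ξ (e i) ^ 2 - 1) (stdGauss ι) t ≤ exp (k * (4 * t ^ 2)) := by
    intro t ht
    rw [hind.mgf_sum hmeas, exp_nat_mul]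
    refine (Finset.prod_le_prod (fun i _ => mgf_nonneg) fun i _ => ?_).trans_eq
      (by rw [Finset.prod_const, Finset.card_univ, Fintype.card_fin])
    rw [← mgf_congr_of_identDistrib _ _ (identDistrib_comp_eval (e i) (hm i))]
    exact mgf_sq_sub_one_le ht
  have hintg : ∀ t : ℝ, |t| ≤ 1 / 4 → Integrable
      (fun ξ => exp (t * (∑ i, fun ξ : ι → ℝ => ξ (e i) ^ 2 - 1) ξ)) (stdGauss ι) := by
    intro t ht
    refine hind.integrable_exp_mul_sum hmeas (fun i _ => ?_)
    exact (measurePreserving_eval (fun _ : ι => gaussianReal 0 1) (e i)).integrable_comp_of_integrable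
      (integrable_exp_sq ht)
  have ht1 : |t| ≤ 1 / 4 := by rwa [abs_of_nonneg ht]
  have ht2 : |-t| ≤ 1 / 4 := by rwa [abs_neg]
  have h1 := measure_ge_le_exp_mul_mgf a ht (hintg t ht1)
  have h2 := measure_le_le_exp_mul_mgf (-a) (neg_nonpos.2 ht) (hintg (-t) ht2)
  have hsub : {ξ : ι → ℝ | a ≤ |∑ i, (ξ (e i) ^ 2 - 1)|} ⊆
      {ξ | a ≤ (∑ i, fun ξ : ι → ℝ => ξ (e i) ^ 2 - 1) ξ} ∪
      {ξ | (∑ i, fun ξ : ι → ℝ => ξ (e i) ^ 2 - 1) ξ ≤ -a} := by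
    intro ξ hξ
    simp only [Set.mem_union, Set.mem_ofPred_eq, Finset.sum_apply]
    rcases le_abs.1 (show a ≤ |_| from hξ) with h | h
    · exact Or.inl h
    · exact Or.inr (by linarith)
  refine (measureReal_mono hsub).trans ((measureReal_union_le _ _).trans ?_)
  rw [two_mul, exp_add]
  refine add_le_add (h1.trans ?_) (h2.trans ?_)
  · exact mul_le_mul_of_nonneg_left (hmgf t ht1) (exp_pos _).le
  · refine (mul_le_mul_of_nonneg_left (hmgf (-t) ht2) (exp_pos _).le).trans_eq ?_
    rw [neg_sq]
    ring_nf

lemma exists_grid_point {a b r : ℝ} (hab : a < b) {N : ℕ} (hN : 0 < N) (hr : r ∈ Set.Icc a b) :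
    ∃ j < N + 1, a + j * ((b - a) / N) ∈ Set.Icc a b ∧ |r - (a + j * ((b - a) / N))| ≤ (b - a) / N := by
  have hN' : (0 : ℝ) < N := by exact_mod_cast hN
  set d := (b - a) / N with hd
  have hd0 : 0 < d := div_pos (sub_pos.2 hab) hN'
  have hNd : N * d = b - a := by rw [hd]; field_simp
  have h0 : 0 ≤ (r - a) / d := div_nonneg (sub_nonneg.2 hr.1) hd0.le
  have h1 : (⌊(r - a) / d⌋₊ : ℝ) * d ≤ r - a := by
    rw [← le_div_iff₀ hd0]; exact Nat.floor_le h0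
  have h2 : r - a < (⌊(r - a) / d⌋₊ + 1 : ℝ) * d := by
    rw [← div_lt_iff₀ hd0]; exact Nat.lt_floor_add_one _
  have hr2 := hr.2
  have h3 : (⌊(r - a) / d⌋₊ : ℝ) * d ≤ N * d := by linarith
  refine ⟨⌊(r - a) / d⌋₊, Nat.lt_succ_of_le (by exact_mod_cast le_of_mul_le_mul_right h3 hd0),
    ⟨by linarith [mul_nonneg (Nat.cast_nonneg (α := ℝ) ⌊(r - a) / d⌋₊) hd0.le], by linarith⟩, ?_⟩
  rw [abs_le]
  constructor <;> linarith

/-- Uniform tail bound for sums of a one-parameter family of Lipschitz functions of independent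
Gaussians. -/
lemma exists_uniform_tail {F : ℝ → ℝ → ℝ} {a b K : ℝ} {L : ℝ≥0} (hab : a < b) (hK : 0 ≤ K)
    (hL : 1 ≤ L) (hF : ∀ r ∈ Set.Icc a b, LipschitzWith L (F r))
    (hr : ∀ r ∈ Set.Icc a b, ∀ r' ∈ Set.Icc a b, ∀ x, |F r x - F r' x| ≤ K * (1 + |x|) * |r - r'|) :
    ∃ C c : ℝ, 0 < C ∧ 0 < c ∧ ∀ {ι : Type} [Fintype ι] {n : ℕ} {e : Fin n → ι}, 0 < n →
      e.Injective → ∀ ε : ℝ, 0 < ε → ε < 1 →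
        (stdGauss ι).real {ξ | ∃ r ∈ Set.Icc a b,
          n * ε ≤ |∑ i, (F r (ξ (e i)) - ∫ x, F r x ∂(gaussianReal 0 1))|} ≤
          C / ε * exp (-c * n * ε ^ 2) := by
  set μ := gaussianReal 0 1 with hμ
  have habs : LipschitzWith 1 fun x : ℝ => |x| :=
    LipschitzWith.of_dist_le_mul fun x y => by
      simpa [Real.dist_eq] using abs_abs_sub_abs_le_abs_sub x y
  have hiabs : Integrable (fun x : ℝ => |x|) μ := integrable_of_lipschitz habs
  set E := ∫ x, |x| ∂μ with hE
  have hE0 : 0 ≤ E := integral_nonneg fun _ => abs_nonneg _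
  set D := 2 * K * (2 * E + 3) * (b - a) with hD
  have hba := sub_pos.2 hab
  have hD0 : 0 ≤ D := by positivity
  have hL0 : (1 : ℝ) ≤ L := by exact_mod_cast hL
  refine ⟨2 * (D + 3) + 2, 1 / (16 * L ^ 2), by positivity, by positivity, ?_⟩
  intro ι _ n e hn he ε hε hε1
  have hn' : (0 : ℝ) < n := by exact_mod_cast hn
  set N := ⌈D / ε⌉₊ + 1 with hN
  have hN0 : 0 < N := Nat.succ_pos _
  have hN0' : (0 : ℝ) < N := by exact_mod_cast hN0
  have hN1 : D / ε ≤ N := by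
    rw [hN]; push_cast; linarith [Nat.le_ceil (D / ε)]
  have hN2 : (N : ℝ) + 1 ≤ (D + 3) / ε := by
    have h1 := Nat.ceil_lt_add_one (div_nonneg hD0 hε.le)
    have h2 : (3 : ℝ) ≤ 3 / ε := by rw [le_div_iff₀ hε]; linarith
    rw [hN, add_div]; push_cast; linarith
  set d := (b - a) / N with hd
  have hd0 : 0 < d := by positivity
  have hKd : K * (2 * E + 3) * d ≤ ε / 2 := by
    rw [div_le_iff₀ hε] at hN1
    rw [hd, ← mul_div_assoc, div_le_iff₀ hN0']
    linarith
  set p : ℕ → ℝ := fun j => a + j * d with hp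
  set T : ℕ → Set (ι → ℝ) := fun j => {ξ | p j ∈ Set.Icc a b ∧
    n * ε / 2 ≤ |∑ i, (F (p j) (ξ (e i)) - ∫ x, F (p j) x ∂μ)|} with hT
  set V : Set (ι → ℝ) := {ξ | (n : ℝ) ≤ |∑ i, (|ξ (e i)| - ∫ x, |x| ∂μ)|} with hV
  have hsub : {ξ : ι → ℝ | ∃ r ∈ Set.Icc a b, n * ε ≤ |∑ i, (F r (ξ (e i)) - ∫ x, F r x ∂μ)|} ⊆
      (⋃ j ∈ Finset.range (N + 1), T j) ∪ V := by
    rintro ξ ⟨r, hrab, hξ⟩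
    by_contra hcon
    simp only [Set.mem_union, Set.mem_iUnion, Finset.mem_range, not_or, not_exists] at hcon
    obtain ⟨hcT, hcV⟩ := hcon
    obtain ⟨j, hj, hjm, hjd⟩ := exists_grid_point hab hN0 hrab
    have h1 : |∑ i, (F (p j) (ξ (e i)) - ∫ x, F (p j) x ∂μ)| < n * ε / 2 := by
      by_contra h
      exact hcT j hj ⟨hjm, not_lt.1 h⟩
    have h2 : |∑ i, (|ξ (e i)| - E)| < n := not_le.1 hcV
    have h3 : ∑ i, |ξ (e i)| ≤ n * (E + 1) := by
      have := (abs_lt.1 h2).2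
      rw [Finset.sum_sub_distrib] at this
      simp at this
      linarith
    have h4 : |∫ x, F r x ∂μ - ∫ x, F (p j) x ∂μ| ≤ K * (1 + E) * d := by
      rw [← integral_sub (integrable_of_lipschitz (hF r hrab))
        (integrable_of_lipschitz (hF _ hjm))]
      refine (abs_integral_le_integral_abs).trans ?_
      have h5 : ∫ x, K * (1 + |x|) * d ∂μ = K * (1 + E) * d := by
        rw [integral_mul_const, integral_const_mul, integral_add (integrable_const _) hiabs]
        simp [hE]
      rw [← h5]
      refine integral_mono ((integrable_of_lipschitz (hF r hrab)).sub
        (integrable_of_lipschitz (hF _ hjm))).abs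
        ((((integrable_const _).add hiabs).const_mul K).mul_const d) fun x => ?_
      exact (hr r hrab _ hjm x).trans (mul_le_mul_of_nonneg_left hjd (by positivity))
    have h6 : |∑ i, (F r (ξ (e i)) - ∫ x, F r x ∂μ) - ∑ i, (F (p j) (ξ (e i)) - ∫ x, F (p j) x ∂μ)|
        ≤ ∑ i, (K * (1 + |ξ (e i)|) * d + K * (1 + E) * d) := by
      rw [← Finset.sum_sub_distrib]
      refine (Finset.abs_sum_le_sum_abs _ _).trans (Finset.sum_le_sum fun i _ => ?_)
      have h7 := (hr r hrab _ hjm (ξ (e i))).trans (mul_le_mul_of_nonneg_left hjd (by positivity))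
      have h8 := abs_sub (F r (ξ (e i)) - F (p j) (ξ (e i))) (∫ x, F r x ∂μ - ∫ x, F (p j) x ∂μ)
      rw [sub_sub_sub_comm]
      linarith
    have h9 : ∑ i, (K * (1 + |ξ (e i)|) * d + K * (1 + E) * d) ≤ n * (ε / 2) := by
      have : ∑ i, (K * (1 + |ξ (e i)|) * d + K * (1 + E) * d) =
          K * d * (n * (2 + E) + ∑ i, |ξ (e i)|) := by
        rw [Finset.sum_add_distrib, ← Finset.sum_mul, ← Finset.mul_sum, Finset.sum_add_distrib]
        simp
        ring
      rw [this]
      have h10 : K * d * (n * (2 + E) + ∑ i, |ξ (e i)|) ≤ K * d * (n * (2 + E) + n * (E + 1)) :=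
        mul_le_mul_of_nonneg_left (by linarith) (by positivity)
      have h11 := mul_le_mul_of_nonneg_left hKd hn'.le
      linarith
    have h12 := abs_sub_abs_le_abs_sub (∑ i, (F r (ξ (e i)) - ∫ x, F r x ∂μ))
      (∑ i, (F (p j) (ξ (e i)) - ∫ x, F (p j) x ∂μ))
    linarith
  have hTb : ∀ j, (stdGauss ι).real (T j) ≤ 2 * exp (-(1 / (16 * L ^ 2)) * n * ε ^ 2) := by
    intro j
    by_cases hj : p j ∈ Set.Icc a b
    · refine (measureReal_mono (fun ξ hξ => hξ.2)).trans
        ((measure_abs_sum_sub_integral_ge he (F := fun _ => F (p j)) (fun _ => hF _ hj)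
          (a := n * ε / 2) (by positivity)).trans_eq ?_)
      congr 2
      field_simp
      ring
    · have : T j = ∅ := Set.eq_empty_of_forall_notMem fun ξ hξ => hj hξ.1
      rw [this]
      simp [exp_nonneg]
  have hVb : (stdGauss ι).real V ≤ 2 * exp (-(1 / (16 * L ^ 2)) * n * ε ^ 2) := by
    refine (measure_abs_sum_sub_integral_ge he (F := fun _ x => |x|) (fun _ => habs)
      hn'.le).trans ?_
    refine mul_le_mul_of_nonneg_left (exp_le_exp.2 ?_) zero_le_two
    have h1 : -(n : ℝ) ^ 2 / (4 * n * ((1 : ℝ≥0) : ℝ) ^ 2) = -(n / 4) := by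
      simp
      field_simp
    have h2 : 1 / (16 * (L : ℝ) ^ 2) ≤ 1 / 4 :=
      one_div_le_one_div_of_le (by norm_num) (by nlinarith)
    have h3 : 1 / (16 * (L : ℝ) ^ 2) * ε ^ 2 ≤ 1 / 4 * 1 :=
      mul_le_mul h2 (by nlinarith) (by positivity) (by norm_num)
    rw [h1]
    nlinarith [mul_le_mul_of_nonneg_left h3 hn'.le]
  refine (measureReal_mono hsub).trans ((measureReal_union_le _ _).trans ?_)
  refine (add_le_add ((measureReal_biUnion_finset_le _ _).trans
    (Finset.sum_le_sum fun j _ => hTb j)) hVb).trans ?_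
  rw [Finset.sum_const, Finset.card_range, nsmul_eq_mul]
  push_cast
  have h1 : (1 : ℝ) ≤ 1 / ε := by rw [le_div_iff₀ hε]; linarith
  have h2 : ((N : ℝ) + 1) * 2 + 2 ≤ (2 * (D + 3) + 2) / ε := by
    have : (2 * (D + 3) + 2) / ε = (D + 3) / ε * 2 + 2 * (1 / ε) := by ring
    linarith
  refine le_trans (le_of_eq ?_) (mul_le_mul_of_nonneg_right h2 (exp_pos _).le)
  ring

/-- The scalar minimum appearing in `phiFn`, in terms of `r = 1 / (2 τ)`. -/
noncomputable def innerMin (lam A r β h : ℝ) : ℝ :=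
  sInf ((fun x : ℝ => β * r * x ^ 2 + lam * x ^ 2 - β * h * x) '' Set.Icc (-A) A)

section innerMin

variable {lam A r β h : ℝ}

lemma innerMin_le {x : ℝ} (hx : |x| ≤ A) :
    innerMin lam A r β h ≤ β * r * x ^ 2 + lam * x ^ 2 - β * h * x := by
  refine csInf_le ?_ ⟨x, abs_le.1 hx, rfl⟩
  exact (isCompact_Icc.image (by fun_prop)).bddBelow

lemma exists_innerMin_eq (hA : 0 < A) :
    ∃ x, |x| ≤ A ∧ innerMin lam A r β h = β * r * x ^ 2 + lam * x ^ 2 - β * h * x := by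
  obtain ⟨x, hx, h⟩ := (isCompact_Icc.image (f := fun x : ℝ => β * r * x ^ 2 + lam * x ^ 2 - β * h * x)
    (by fun_prop)).sInf_mem ((Set.nonempty_Icc.2 (by linarith : -A ≤ A)).image _)
  exact ⟨x, abs_le.2 hx, h.symm⟩

lemma innerMin_nonpos (hA : 0 < A) : innerMin lam A r β h ≤ 0 := by
  simpa using innerMin_le (lam := lam) (r := r) (β := β) (h := h) (x := 0) (by simpa using hA.le)

lemma innerMin_sub_le (hA : 0 < A) {r' β' h' K : ℝ}
    (hK : ∀ x, |x| ≤ A → |(β * r - β' * r') * x ^ 2 - (β * h - β' * h') * x| ≤ K) :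
    |innerMin lam A r β h - innerMin lam A r' β' h'| ≤ K := by
  obtain ⟨x, hx, ex⟩ := exists_innerMin_eq (lam := lam) (r := r) (β := β) (h := h) hA
  obtain ⟨y, hy, ey⟩ := exists_innerMin_eq (lam := lam) (r := r') (β := β') (h := h') hA
  have h1 := innerMin_le (lam := lam) (r := r') (β := β') (h := h') hx
  have h2 := innerMin_le (lam := lam) (r := r) (β := β) (h := h) hy
  have h3 := abs_le.1 (hK x hx)
  have h4 := abs_le.1 (hK y hy)
  rw [abs_le]
  constructor <;> linarith

lemma lipschitzWith_innerMin (hA : 0 < A) {L : ℝ≥0} (hL : |β| * A ≤ L) :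
    LipschitzWith L (innerMin lam A r β) := by
  refine LipschitzWith.of_dist_le_mul fun h h' => ?_
  rw [Real.dist_eq, Real.dist_eq]
  refine innerMin_sub_le hA fun x hx => ?_
  have e : (β * r - β * r) * x ^ 2 - (β * h - β * h') * x = -(β * x * (h - h')) := by ring
  rw [e, abs_neg, abs_mul, abs_mul]
  exact mul_le_mul_of_nonneg_right ((mul_le_mul_of_nonneg_left hx (abs_nonneg _)).trans hL)
    (abs_nonneg _)

lemma innerMin_sub_le_of_r (hA : 0 < A) (r' : ℝ) :
    |innerMin lam A r β h - innerMin lam A r' β h| ≤ |β| * A ^ 2 * (1 + |h|) * |r - r'| := by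
  refine innerMin_sub_le hA fun x hx => ?_
  have e : (β * r - β * r') * x ^ 2 - (β * h - β * h) * x = β * x ^ 2 * (r - r') := by ring
  rw [e, abs_mul, abs_mul, abs_pow]
  refine mul_le_mul_of_nonneg_right ?_ (abs_nonneg _)
  have h1 : |x| ^ 2 ≤ A ^ 2 := pow_le_pow_left₀ (abs_nonneg _) hx 2
  have h2 : |β| * |x| ^ 2 ≤ |β| * A ^ 2 := mul_le_mul_of_nonneg_left h1 (abs_nonneg _)
  have h3 : 0 ≤ |β| * A ^ 2 * |h| := by positivity
  linarith

lemma innerMin_sub_le_of_beta (hA : 0 < A) (β' : ℝ) :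
    |innerMin lam A r β h - innerMin lam A r β' h| ≤ (|r| * A ^ 2 + A) * (1 + |h|) * |β - β'| := by
  refine innerMin_sub_le hA fun x hx => ?_
  have e : (β * r - β' * r) * x ^ 2 - (β * h - β' * h) * x = (r * x ^ 2 - h * x) * (β - β') := by ring
  rw [e, abs_mul]
  refine mul_le_mul_of_nonneg_right ((abs_sub _ _).trans ?_) (abs_nonneg _)
  rw [abs_mul, abs_mul, abs_pow]
  have h1 : |r| * |x| ^ 2 ≤ |r| * A ^ 2 :=
    mul_le_mul_of_nonneg_left (pow_le_pow_left₀ (abs_nonneg _) hx 2) (abs_nonneg _)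
  have h2 : |h| * |x| ≤ |h| * A := mul_le_mul_of_nonneg_left hx (abs_nonneg _)
  have h3 : 0 ≤ |r| * A ^ 2 * |h| := by positivity
  nlinarith [hA]

end innerMin

/-- The Euclidean norm of a real vector. -/
noncomputable def l2 {k : ℕ} (x : Fin k → ℝ) : ℝ := √(x ⬝ᵥ x)

section l2

variable {k : ℕ} (x y : Fin k → ℝ)

lemma dotProduct_self_nonneg' : 0 ≤ x ⬝ᵥ x := Finset.sum_nonneg fun _ _ => mul_self_nonneg _

lemma l2_nonneg : 0 ≤ l2 x := sqrt_nonneg _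

lemma l2_sq : l2 x ^ 2 = x ⬝ᵥ x := sq_sqrt (dotProduct_self_nonneg' x)

lemma dotProduct_le_l2_mul_l2 : x ⬝ᵥ y ≤ l2 x * l2 y := by
  have := Real.sum_mul_le_sqrt_mul_sqrt Finset.univ x y
  simpa [l2, dotProduct, sq] using this

lemma l2_smul (c : ℝ) (hc : 0 ≤ c) : l2 (c • x) = c * l2 x := by
  rw [l2, smul_dotProduct, dotProduct_smul, smul_smul, smul_eq_mul, sqrt_mul (mul_self_nonneg c),
    sqrt_mul_self hc, l2]

lemma exists_aligned (hk : 0 < k) {c : ℝ} (hc : 0 ≤ c) : ∃ u, l2 u = c ∧ u ⬝ᵥ x = c * l2 x := by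
  rcases (l2_nonneg x).eq_or_lt with h | h
  · have hx : x ⬝ᵥ x = 0 := by rw [← l2_sq, ← h]; simp
    obtain rfl : x = 0 := dotProduct_self_eq_zero.1 hx
    refine ⟨c • Pi.single ⟨0, hk⟩ 1, ?_, by simp [l2]⟩
    rw [l2_smul _ _ hc]
    simp [l2]
  · refine ⟨(c / l2 x) • x, ?_, ?_⟩
    · rw [l2_smul _ _ (by positivity)]
      field_simp
    · rw [smul_dotProduct, ← l2_sq, smul_eq_mul]
      field_simp

lemma l2_le {A : ℝ} (hA : 0 ≤ A) (hx : ∀ i, |x i| ≤ A) : l2 x ≤ √k * A := by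
  refine Real.sqrt_le_iff.2 ⟨by positivity, ?_⟩
  rw [mul_pow, sq_sqrt (Nat.cast_nonneg k)]
  refine (Finset.sum_le_sum fun i _ => ?_).trans_eq (b := ∑ _ : Fin k, A ^ 2) (by simp)
  rw [← sq]
  exact sq_le_sq' (abs_le.1 (hx i)).1 (abs_le.1 (hx i)).2

end l2

/-- The bilinear form of Gordon's auxiliary process. -/
noncomputable def aoForm {m n : ℕ} (g : Fin m → ℝ) (h x : Fin n → ℝ) (u : Fin m → ℝ) : ℝ :=
  l2 x * (g ⬝ᵥ u) + l2 u * (h ⬝ᵥ x)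

/-- The threshold with which the bilinear form is compared. -/
noncomputable def threshold {m n : ℕ} (lam ρ : ℝ) (s : Fin m → ℝ) (t : ℝ) (x : Fin n → ℝ)
    (u : Fin m → ℝ) : ℝ :=
  √n / 2 * (n * t + 2 * √ρ * (u ⬝ᵥ s) + u ⬝ᵥ u - lam * (x ⬝ᵥ x))

lemma phiFn_eq (δ lam ρ A τ β : ℝ) : phiFn δ lam ρ A τ β = τ * β * δ / 2 + ρ * β / (2 * τ) - β ^ 2 / 4 +
    ∫ h, innerMin lam A (2 * τ)⁻¹ β h ∂(gaussianReal 0 1) := by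
  simp only [phiFn, innerMin, div_eq_mul_inv β]

section deterministic

variable {δ lam ρ A ε : ℝ} {m n : ℕ} {s g : Fin m → ℝ} {h : Fin n → ℝ}

lemma abs_residual_sub_le (hρ : 0 < ρ) (hm : (m : ℝ) = δ * n)
    (hs : ∀ k, s k = 1 ∨ s k = -1) (h1 : |∑ k, (g k ^ 2 - 1)| < n * ε)
    (h2 : |∑ k, s k * g k| < n * ε) {a : ℝ} (ha : 0 ≤ a) (haA : a ≤ A) :
    |(a • g - √ρ • s) ⬝ᵥ (a • g - √ρ • s) - n * (δ * (ρ + a ^ 2))| ≤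
      n * ((A ^ 2 + 2 * √ρ * A) * ε) := by
  have hss : s ⬝ᵥ s = m := by
    have : ∀ k, s k * s k = 1 := fun k => by rcases hs k with h | h <;> simp [h]
    simp [dotProduct, this]
  have hgg : ∑ k, (g k ^ 2 - 1) = g ⬝ᵥ g - m := by
    simp [dotProduct, sq]
  have hsg : ∑ k, s k * g k = s ⬝ᵥ g := rfl
  have e : (a • g - √ρ • s) ⬝ᵥ (a • g - √ρ • s) - n * (δ * (ρ + a ^ 2)) =
      a ^ 2 * (g ⬝ᵥ g - m) - 2 * √ρ * a * (s ⬝ᵥ g) := by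
    simp only [sub_dotProduct, dotProduct_sub, smul_dotProduct, dotProduct_smul, smul_eq_mul, hss,
      dotProduct_comm g s]
    rw [hm]
    linear_combination (δ * n) * (mul_self_sqrt hρ.le)
  rw [e]
  rw [hgg] at h1
  rw [hsg] at h2
  have h3 := abs_sub (a ^ 2 * (g ⬝ᵥ g - m)) (2 * √ρ * a * (s ⬝ᵥ g))
  rw [abs_mul, abs_mul, abs_of_nonneg (sq_nonneg a),
    abs_of_nonneg (by positivity : 0 ≤ 2 * √ρ * a)] at h3
  have h4 : a ^ 2 * |g ⬝ᵥ g - m| ≤ A ^ 2 * (n * ε) :=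
    mul_le_mul (pow_le_pow_left₀ ha haA 2) h1.le (abs_nonneg _) (sq_nonneg _)
  have h5 : 2 * √ρ * a * |s ⬝ᵥ g| ≤ 2 * √ρ * A * (n * ε) :=
    mul_le_mul (by gcongr) h2.le (abs_nonneg _) (by have := ha.trans haA; positivity)
  linarith

lemma ao_identity (hn : 0 < n) (lam ρ t : ℝ) (s g : Fin m → ℝ) (h x : Fin n → ℝ) (u : Fin m → ℝ) :
    √n / 2 * (2 * (u ⬝ᵥ ((l2 x / √n) • g - √ρ • s)) + 2 * (l2 u / √n) * (h ⬝ᵥ x) - u ⬝ᵥ u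
      + lam * (x ⬝ᵥ x) - n * t) = aoForm g h x u - threshold lam ρ s t x u := by
  have hp : 0 < √(n : ℝ) := sqrt_pos.2 (by exact_mod_cast hn)
  rw [aoForm, threshold, dotProduct_sub, dotProduct_smul, dotProduct_smul, dotProduct_comm u g]
  simp only [smul_eq_mul]
  field_simp
  ring

lemma sqrt_mul_le_of_le_sq {S S₀ K z : ℝ} (hS₀ : 0 < S₀) (hS : S₀ ≤ S) (hK : 0 ≤ K)
    (hε : 0 ≤ ε) (hz : 0 ≤ z) (h : n * (S ^ 2 - K * ε) ≤ z ^ 2) :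
    √n * (S - K / S₀ * ε) ≤ z := by
  have hd : K * ε ≤ S * (K / S₀ * ε) := by
    have : K * ε = S₀ * (K / S₀ * ε) := by field_simp
    rw [this]
    exact mul_le_mul_of_nonneg_right hS (by positivity)
  set e := K / S₀ * ε with he
  have he0 : 0 ≤ e := by positivity
  rcases le_or_gt (S - e) 0 with hle | hgt
  · exact (mul_nonpos_of_nonneg_of_nonpos (sqrt_nonneg _) hle).trans hz
  · refine (abs_le_of_sq_le_sq' ?_ hz).2
    rw [mul_pow, sq_sqrt (Nat.cast_nonneg n)]
    exact (mul_le_mul_of_nonneg_left (by nlinarith) (Nat.cast_nonneg n)).trans h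

lemma sqrt_mul_le_of_sq_le {τ K q z : ℝ} (hδ : 0 < δ) (hτ : 0 < τ)
    (h : z ^ 2 ≤ n * (δ * q) + n * (K * ε)) :
    √n * z ≤ n * (τ * δ / 2 + q / (2 * τ) + K / (2 * τ * δ) * ε) := by
  have h1 : √n * z ≤ n * (τ * δ / 2) + z ^ 2 / (2 * τ * δ) := by
    have h2 : (√n) ^ 2 = (n : ℝ) := sq_sqrt (Nat.cast_nonneg n)
    have h3 : n * (τ * δ / 2) + z ^ 2 / (2 * τ * δ) - √n * z =
        (√n * (τ * δ) - z) ^ 2 / (2 * τ * δ) := by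
      have e : ∀ p N : ℝ, p ^ 2 = N → N * (τ * δ / 2) + z ^ 2 / (2 * τ * δ) - p * z =
          (p * (τ * δ) - z) ^ 2 / (2 * τ * δ) := by
        rintro p _ rfl
        field_simp
        ring
      exact e _ _ h2
    have h4 : 0 ≤ (√n * (τ * δ) - z) ^ 2 / (2 * τ * δ) := by positivity
    linarith
  have h5 : z ^ 2 / (2 * τ * δ) ≤ (n * (δ * q) + n * (K * ε)) / (2 * τ * δ) := by gcongr
  refine h1.trans ((add_le_add_right h5 _).trans_eq ?_)
  field_simp
  ring

lemma le_of_aoForm_le (hδ : 0 < δ) (hρ : 0 < ρ) (hA : 0 < A) (hn : 0 < n) (hm : (m : ℝ) = δ * n)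
    (hs : ∀ k, s k = 1 ∨ s k = -1) (hε : 0 < ε) {β φ₀ t : ℝ} (hβ : 0 < β)
    (hφ : ∀ τ, 0 < τ → φ₀ ≤ phiFn δ lam ρ A τ β)
    (h1 : |∑ k, (g k ^ 2 - 1)| < n * ε) (h2 : |∑ k, s k * g k| < n * ε)
    (h3 : ∀ r ∈ Set.Icc (δ / (2 * √(δ * (ρ + A ^ 2)))) (δ / (2 * √(δ * ρ))),
      |∑ i, (innerMin lam A r β (h i) - ∫ y, innerMin lam A r β y ∂(gaussianReal 0 1))| < n * ε)
    {x : Fin n → ℝ} (hx : ∀ i, |x i| ≤ A) (hAO : ∀ u, aoForm g h x u ≤ threshold lam ρ s t x u) :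
    φ₀ - (1 + β * ((A ^ 2 + 2 * √ρ * A) / √(δ * ρ))) * ε ≤ t := by
  have hn' : (0 : ℝ) < n := by exact_mod_cast hn
  have hp : 0 < √(n : ℝ) := sqrt_pos.2 hn'
  have hpp : √(n : ℝ) * √(n : ℝ) = n := mul_self_sqrt hn'.le
  have hm0 : 0 < m := by
    have : (0 : ℝ) < m := by rw [hm]; positivity
    exact_mod_cast this
  set p := √(n : ℝ) with hpdef
  set a := l2 x / p with ha
  have ha0 : 0 ≤ a := div_nonneg (l2_nonneg x) hp.le
  have haA : a ≤ A := by
    rw [ha, div_le_iff₀ hp, mul_comm]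
    exact l2_le x hA.le hx
  have hxx : x ⬝ᵥ x = n * a ^ 2 := by
    rw [ha, div_pow, l2_sq, sq, hpp]
    field_simp
  set w := a • g - √ρ • s with hw
  set K := A ^ 2 + 2 * √ρ * A with hK
  have hK0 : 0 ≤ K := by positivity
  have hW := abs_residual_sub_le hρ hm hs h1 h2 ha0 haA
  rw [← hw, ← l2_sq] at hW
  set S := √(δ * (ρ + a ^ 2)) with hS
  have hSS : S * S = δ * (ρ + a ^ 2) := mul_self_sqrt (by positivity)
  have hS0 : 0 < √(δ * ρ) := sqrt_pos.2 (by positivity)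
  have hSl : √(δ * ρ) ≤ S := sqrt_le_sqrt (by nlinarith [sq_nonneg a])
  have hSu : S ≤ √(δ * (ρ + A ^ 2)) := by
    refine sqrt_le_sqrt (mul_le_mul_of_nonneg_left ?_ hδ.le)
    linarith [pow_le_pow_left₀ ha0 haA 2]
  have hSp : 0 < S := hS0.trans_le hSl
  have hZ : p * (S - K / √(δ * ρ) * ε) ≤ l2 w :=
    sqrt_mul_le_of_le_sq hS0 hSl hK0 hε.le (l2_nonneg w) (by
      rw [sq S, hSS]
      linarith only [(abs_le.1 hW).1])
  obtain ⟨u, hu1, hu2⟩ := exists_aligned w hm0 (c := β * p / 2) (by positivity)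
  have h4 := ao_identity hn lam ρ t s g h x u
  have h5 : 2 * (u ⬝ᵥ w) + 2 * (l2 u / p) * (h ⬝ᵥ x) - u ⬝ᵥ u + lam * (x ⬝ᵥ x) - n * t ≤ 0 := by
    by_contra hcon
    have := mul_pos (half_pos hp) (not_le.1 hcon)
    rw [h4] at this
    linarith [hAO u]
  rw [hu2, ← l2_sq u, hu1] at h5
  have h6 : 2 * (β * p / 2 / p) * (h ⬝ᵥ x) = β * (h ⬝ᵥ x) := by field_simp
  have h7 : (β * p / 2) ^ 2 = n * (β ^ 2 / 4) := by rw [← hpp]; ring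
  rw [h6, h7] at h5
  set τ := S / δ with hτ
  have hτ0 : 0 < τ := div_pos hSp hδ
  have hr : (2 * τ)⁻¹ = δ / (2 * S) := by rw [hτ]; field_simp
  have hsum : ∑ i, innerMin lam A (2 * τ)⁻¹ β (h i) ≤
      β * (2 * τ)⁻¹ * (x ⬝ᵥ x) + lam * (x ⬝ᵥ x) + β * (h ⬝ᵥ x) := by
    simp only [dotProduct, Finset.mul_sum, ← Finset.sum_add_distrib]
    refine Finset.sum_le_sum fun i _ => ?_
    refine (innerMin_le (x := -x i) (by rw [abs_neg]; exact hx i)).trans_eq ?_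
    ring
  have hG := (abs_lt.1 (h3 (2 * τ)⁻¹ ⟨by rw [hr]; gcongr, by rw [hr]; gcongr⟩)).1
  rw [Finset.sum_sub_distrib, Finset.sum_const, Finset.card_univ, Fintype.card_fin,
    nsmul_eq_mul] at hG
  have hφτ := hφ τ hτ0
  rw [phiFn_eq] at hφτ
  set I := ∫ y, innerMin lam A (2 * τ)⁻¹ β y ∂(gaussianReal 0 1) with hI
  have hid : τ * β * δ / 2 + ρ * β / (2 * τ) = β * S - β * (2 * τ)⁻¹ * a ^ 2 := by
    rw [hτ]
    field_simp
    linear_combination (-1) * hSS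
  have hZ' : β * p * (p * (S - K / √(δ * ρ) * ε)) ≤ β * p * l2 w :=
    mul_le_mul_of_nonneg_left hZ (by positivity)
  have hZ'' : β * p * (p * (S - K / √(δ * ρ) * ε)) = n * (β * (S - K / √(δ * ρ) * ε)) := by
    rw [← hpp]; ring
  rw [hid] at hφτ
  rw [hxx] at hsum h5
  have hfin : n * (φ₀ - (1 + β * (K / √(δ * ρ))) * ε) ≤ n * t := by
    have h8 := mul_le_mul_of_nonneg_left hφτ hn'.le
    rw [hZ''] at hZ'
    generalize K / √(δ * ρ) = κ at *
    clear_value S p a w I τ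
    linarith only [h8, hZ', hG, hsum, h5]
  exact le_of_mul_le_mul_left hfin hn'

lemma phiFn_zero_right (hlam : 0 ≤ lam) (hA : 0 < A) (τ : ℝ) : phiFn δ lam ρ A τ 0 = 0 := by
  have : ∀ y, innerMin lam A (2 * τ)⁻¹ 0 y = 0 := fun y => by
    refine le_antisymm (innerMin_nonpos hA) ?_
    obtain ⟨x, -, hx⟩ := exists_innerMin_eq (lam := lam) (r := (2 * τ)⁻¹) (β := 0) (h := y) hA
    rw [hx]
    have : 0 ≤ lam * x ^ 2 := by positivity
    linarith
  rw [phiFn_eq, integral_congr_ae (Filter.Eventually.of_forall this)]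
  simp

lemma upper_arith {N β X q I φ₀ B κ T t : ℝ} (h8 : N * (β * X - q + I) ≤ N * φ₀)
    (h9 : N * (β * (κ * ε)) ≤ N * (B * (κ * ε))) (hG : T - N * I < N * ε)
    (hmain : N * t ≤ N * (β * X + β * (κ * ε) - q) + T) :
    N * t ≤ N * (φ₀ + (1 + B * κ) * ε) := by
  linarith only [h8, h9, hG, hmain]

lemma le_of_le_aoForm (hδ : 0 < δ) (hlam : 0 ≤ lam) (hρ : 0 < ρ) (hA : 0 < A) (hn : 0 < n)
    (hm : (m : ℝ) = δ * n) (hs : ∀ k, s k = 1 ∨ s k = -1) (hε : 0 < ε) (hε1 : ε < 1)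
    {τ φ₀ t K₂ B : ℝ} (hτ : 0 < τ) (hφ : ∀ β, 0 ≤ β → phiFn δ lam ρ A τ β ≤ φ₀)
    (hK₂ : K₂ = (A ^ 2 + 2 * √ρ * A) / (2 * τ * δ))
    (hB : B = 4 * (τ * δ / 2 + ρ / (2 * τ) + K₂))
    (h1 : |∑ k, (g k ^ 2 - 1)| < n * ε) (h2 : |∑ k, s k * g k| < n * ε)
    (h3 : ∀ β ∈ Set.Icc 0 B, |∑ i, (innerMin lam A (2 * τ)⁻¹ β (h i) -
      ∫ y, innerMin lam A (2 * τ)⁻¹ β y ∂(gaussianReal 0 1))| < n * ε)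
    {u : Fin m → ℝ}
    (hAO : ∀ x : Fin n → ℝ, (∀ i, |x i| ≤ A) → threshold lam ρ s t x u ≤ aoForm g h x u) :
    t ≤ φ₀ + (1 + B * K₂) * ε := by
  have hn' : (0 : ℝ) < n := by exact_mod_cast hn
  have hp : 0 < √(n : ℝ) := sqrt_pos.2 hn'
  have hpp : √(n : ℝ) * √(n : ℝ) = n := mul_self_sqrt hn'.le
  set p := √(n : ℝ) with hpdef
  have hK₂0 : 0 ≤ K₂ := by rw [hK₂]; positivity
  have hB0 : 0 ≤ B := by rw [hB]; positivity
  have hφ0 : 0 ≤ φ₀ := (phiFn_zero_right hlam hA τ).symm.le.trans (hφ 0 le_rfl)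
  rcases le_or_gt t 0 with ht | ht
  · exact ht.trans (by positivity)
  set β := 2 * (l2 u / p) with hβ
  have hβ0 : 0 ≤ β := by have := l2_nonneg u; positivity
  choose y hyA hy using fun i => exists_innerMin_eq (lam := lam) (r := (2 * τ)⁻¹) (β := β) (h := h i) hA
  set x : Fin n → ℝ := fun i => -y i with hx
  have hxA : ∀ i, |x i| ≤ A := fun i => by rw [hx, abs_neg]; exact hyA i
  set a := l2 x / p with ha
  have ha0 : 0 ≤ a := div_nonneg (l2_nonneg x) hp.le
  have haA : a ≤ A := by
    rw [ha, div_le_iff₀ hp, mul_comm]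
    exact l2_le x hA.le hxA
  have hxx : x ⬝ᵥ x = n * a ^ 2 := by
    rw [ha, div_pow, l2_sq, sq, hpp]
    field_simp
  set w := a • g - √ρ • s with hw
  have hW := abs_residual_sub_le hρ hm hs h1 h2 ha0 haA
  rw [← hw, ← l2_sq] at hW
  have h4 := ao_identity hn lam ρ t s g h x u
  have h5 : 0 ≤ 2 * (u ⬝ᵥ w) + 2 * (l2 u / p) * (h ⬝ᵥ x) - u ⬝ᵥ u + lam * (x ⬝ᵥ x) - n * t := by
    by_contra hcon
    have := mul_neg_of_pos_of_neg (half_pos hp) (not_le.1 hcon)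
    rw [h4] at this
    linarith [hAO x hxA]
  rw [← hβ, ← l2_sq u] at h5
  have hlu : l2 u = β * p / 2 := by rw [hβ]; field_simp
  have h6 := dotProduct_le_l2_mul_l2 u w
  rw [hlu] at h5 h6
  have h7 : (β * p / 2) ^ 2 = n * (β ^ 2 / 4) := by rw [← hpp]; ring
  rw [h7] at h5
  have hZ : p * l2 w ≤ n * (τ * δ / 2 + (ρ + a ^ 2) / (2 * τ) + K₂ * ε) := by
    rw [hK₂]
    exact sqrt_mul_le_of_sq_le hδ hτ (by linarith only [(abs_le.1 hW).2])
  have hsum : ∑ i, innerMin lam A (2 * τ)⁻¹ β (h i) =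
      β * (2 * τ)⁻¹ * (x ⬝ᵥ x) + lam * (x ⬝ᵥ x) + β * (h ⬝ᵥ x) := by
    simp only [dotProduct, Finset.mul_sum, ← Finset.sum_add_distrib]
    refine Finset.sum_congr rfl fun i _ => ?_
    rw [hy, hx]
    ring
  have hZ' := mul_le_mul_of_nonneg_left hZ hβ0
  rw [hxx] at hsum h5
  have hmain : n * t ≤ n * (β * (τ * δ / 2 + ρ / (2 * τ) + K₂ * ε) - β ^ 2 / 4) +
      ∑ i, innerMin lam A (2 * τ)⁻¹ β (h i) := by
    have e : (ρ + a ^ 2) / (2 * τ) = ρ / (2 * τ) + (2 * τ)⁻¹ * a ^ 2 := by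
      rw [add_div, div_eq_inv_mul (a ^ 2)]
    rw [e] at hZ'
    clear_value p a w β
    linarith only [hZ', hsum, h5, mul_le_mul_of_nonneg_left h6 zero_le_two]
  have hneg : ∑ i, innerMin lam A (2 * τ)⁻¹ β (h i) ≤ 0 :=
    Finset.sum_nonpos fun i _ => innerMin_nonpos hA
  have hβB : β ≤ B := by
    by_contra hcon
    have h8 : 0 < n * (β * (τ * δ / 2 + ρ / (2 * τ) + K₂ * ε) - β ^ 2 / 4) := by
      linarith only [mul_pos hn' ht, hmain, hneg]
    have h9 := pos_of_mul_pos_right h8 hn'.le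
    have h10 : K₂ * ε ≤ K₂ := mul_le_of_le_one_right hK₂0 hε1.le
    have h11 : β * (τ * δ / 2 + ρ / (2 * τ) + K₂ * ε) ≤ β * (B / 4) :=
      mul_le_mul_of_nonneg_left (by rw [hB]; linarith only [h10]) hβ0
    linarith only [h9, h11, mul_nonneg hβ0 (sub_nonneg.2 (not_le.1 hcon).le)]
  have hG := (abs_lt.1 (h3 β ⟨hβ0, hβB⟩)).2
  rw [Finset.sum_sub_distrib, Finset.sum_const, Finset.card_univ, Fintype.card_fin,
    nsmul_eq_mul] at hG
  have hφβ := hφ β hβ0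
  rw [phiFn_eq] at hφβ
  have hbk : β * (K₂ * ε) ≤ B * (K₂ * ε) := mul_le_mul_of_nonneg_right hβB (by positivity)
  have e : τ * β * δ / 2 + ρ * β / (2 * τ) = β * (τ * δ / 2 + ρ / (2 * τ)) := by ring
  rw [e] at hφβ
  have hfin : n * t ≤ n * (φ₀ + (1 + B * K₂) * ε) := by
    have h8 := mul_le_mul_of_nonneg_left hφβ hn'.le
    have h9 := mul_le_mul_of_nonneg_left hbk hn'.le
    rw [mul_add β] at hmain
    exact upper_arith h8 h9 hG hmain
  exact le_of_mul_le_mul_left hfin hn'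

end deterministic

/-- Reflecting one coordinate leaves the standard Gaussian measure invariant. -/
lemma measurePreserving_update_neg_stdGauss {ι : Type*} [Fintype ι] [DecidableEq ι] (j : ι) :
    MeasurePreserving (fun ξ : ι → ℝ => Function.update ξ j (-ξ j)) (stdGauss ι) (stdGauss ι) := by
  have h := measurePreserving_pi (fun _ : ι => gaussianReal 0 1) (fun _ : ι => gaussianReal 0 1)
    (f := fun i => if i = j then fun x => -x else id) fun i => by
      by_cases hi : i = j
      · rw [if_pos hi]
        exact ⟨measurable_neg, by rw [gaussianReal_map_neg, neg_zero]⟩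
      · rw [if_neg hi]
        exact MeasurePreserving.id _
  refine (congrArg (fun f => MeasurePreserving f (stdGauss ι) (stdGauss ι)) ?_).mp h
  ext ξ i
  by_cases hi : i = j
  · subst hi; simp
  · simp [hi]

/-- Conditioning on the sign of an irrelevant coordinate costs at most a factor of two. -/
lemma stdGauss_le_two_mul {ι : Type*} [Fintype ι] [DecidableEq ι] (j : ι) {E : Set (ι → ℝ)}
    (hE : MeasurableSet E) (hinv : ∀ ξ a, ξ ∈ E → Function.update ξ j a ∈ E) :
    stdGauss ι E ≤ 2 * stdGauss ι (E ∩ {ξ | ξ j ≤ 0}) := by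
  have hm : MeasurableSet (E ∩ {ξ | ξ j ≤ 0}) :=
    hE.inter (measurableSet_le (measurable_pi_apply j) measurable_const)
  calc stdGauss ι E ≤ stdGauss ι ((E ∩ {ξ | ξ j ≤ 0}) ∪
        (fun ξ : ι → ℝ => Function.update ξ j (-ξ j)) ⁻¹' (E ∩ {ξ | ξ j ≤ 0})) := by
        refine measure_mono fun ξ hξ => ?_
        rcases le_total (ξ j) 0 with h | h
        · exact Or.inl ⟨hξ, h⟩
        · exact Or.inr ⟨hinv _ _ hξ, by simpa using h⟩
    _ ≤ _ := measure_union_le _ _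
    _ = _ := by
        rw [(measurePreserving_update_neg_stdGauss j).measure_preimage hm.nullMeasurableSet,
          two_mul]

section transfer

variable {m n : ℕ}

/-- The index set of the coordinates of Gordon's processes: the matrix, an extra scalar, and the
two auxiliary vectors. -/
abbrev GordonIdx (m n : ℕ) : Type := (Fin m × Fin n) ⊕ (Unit ⊕ (Fin m ⊕ Fin n))

/-- The auxiliary Gaussian vector indexed by the rows. -/
def rowVec (ξ : GordonIdx m n → ℝ) : Fin m → ℝ := fun k => ξ (.inr (.inr (.inl k)))

/-- The auxiliary Gaussian vector indexed by the columns. -/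
def colVec (ξ : GordonIdx m n → ℝ) : Fin n → ℝ := fun i => ξ (.inr (.inr (.inr i)))

/-- The random matrix, rescaled to have entries of variance `1/n`. -/
noncomputable def scaledMat (ξ : GordonIdx m n → ℝ) : Fin m → Fin n → ℝ :=
  fun k i => ξ (.inl (k, i)) / √n

lemma measurePreserving_scaledMat :
    MeasurePreserving scaledMat (stdGauss (GordonIdx m n)) (matMeasure m n) := by
  have h1 := measurePreserving_sumPiEquivProdPi
    (fun _ : GordonIdx m n => gaussianReal 0 1)
  have h2 := measurePreserving_fst (μ := Measure.pi fun _ : Fin m × Fin n => gaussianReal 0 1)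
    (ν := Measure.pi fun _ : Unit ⊕ (Fin m ⊕ Fin n) => gaussianReal 0 1)
  have h3 : MeasurePreserving (MeasurableEquiv.curry (Fin m) (Fin n) ℝ)
      (Measure.pi fun _ : Fin m × Fin n => gaussianReal 0 1)
      (Measure.pi fun _ : Fin m => Measure.pi fun _ : Fin n => gaussianReal 0 1) := by
    refine ⟨MeasurableEquiv.measurable _, ?_⟩
    have := Measure.infinitePi_map_curry (fun (_ : Fin m) (_ : Fin n) => gaussianReal 0 1)
    simpa only [Measure.infinitePi_eq_pi] using this
  have h4 : MeasurePreserving (fun x : ℝ => x / √n) (gaussianReal 0 1)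
      (gaussianReal 0 ((n : ℝ≥0))⁻¹) := by
    refine ⟨by fun_prop, ?_⟩
    rw [gaussianReal_map_div_const, zero_div]
    congr 1
    ext
    simp
  have h5 := measurePreserving_pi _ _ fun _ : Fin m => measurePreserving_pi _ _ fun _ : Fin n => h4
  exact h5.comp (h3.comp (h2.comp h1))

/-- Coefficients of the primary Gaussian process. -/
noncomputable def primaryCoef (σ : ℝ) (x : Fin n → ℝ) (u : Fin m → ℝ) : GordonIdx m n → ℝ
  | .inl p => σ * (u p.1 * x p.2)
  | .inr (.inl _) => l2 x * l2 u
  | .inr (.inr _) => 0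

/-- Coefficients of the auxiliary Gaussian process. -/
noncomputable def auxCoef (σ : ℝ) (x : Fin n → ℝ) (u : Fin m → ℝ) : GordonIdx m n → ℝ
  | .inl _ => 0
  | .inr (.inl _) => 0
  | .inr (.inr (.inl k)) => σ * (l2 x * u k)
  | .inr (.inr (.inr i)) => σ * (l2 u * x i)

variable {σ : ℝ} (x x' : Fin n → ℝ) (u u' : Fin m → ℝ) (ξ : GordonIdx m n → ℝ)

lemma sum_primaryCoef_mul (hn : 0 < n) : ∑ i, primaryCoef σ x u i * ξ i =
    σ * (√n * (u ⬝ᵥ mulV (scaledMat ξ) x)) + l2 x * l2 u * ξ (.inr (.inl ())) := by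
  have hp : √(n : ℝ) ≠ 0 := (sqrt_pos.2 (by exact_mod_cast hn)).ne'
  simp only [primaryCoef, Fintype.sum_sum_type, Fintype.sum_prod_type, dotProduct, mulV, scaledMat,
    Finset.mul_sum, Finset.univ_unique, Finset.sum_singleton, zero_mul, Finset.sum_const_zero,
    add_zero, PUnit.default_eq_unit]
  congr 1
  refine Finset.sum_congr rfl fun k _ => Finset.sum_congr rfl fun i _ => ?_
  field_simp

lemma sum_auxCoef_mul : ∑ i, auxCoef σ x u i * ξ i =
    σ * aoForm (rowVec ξ) (colVec ξ) x u := by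
  simp only [auxCoef, Fintype.sum_sum_type, dotProduct, aoForm, rowVec, colVec,
    Finset.mul_sum, zero_mul, Finset.sum_const_zero, zero_add, mul_add]
  congr 1 <;> exact Finset.sum_congr rfl fun _ _ => by ring

lemma primaryCoef_gram (hσ : σ * σ = 1) : ∑ i, primaryCoef σ x u i * primaryCoef σ x' u' i =
    (u ⬝ᵥ u') * (x ⬝ᵥ x') + l2 x * l2 u * (l2 x' * l2 u') := by
  simp only [primaryCoef, Fintype.sum_sum_type, Fintype.sum_prod_type, dotProduct,
    Finset.sum_mul_sum, Finset.univ_unique, Finset.sum_singleton, zero_mul, Finset.sum_const_zero,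
    add_zero]
  congr 1
  refine Finset.sum_congr rfl fun k _ => Finset.sum_congr rfl fun i _ => ?_
  linear_combination (u k * x i * (u' k * x' i)) * hσ

lemma auxCoef_gram (hσ : σ * σ = 1) : ∑ i, auxCoef σ x u i * auxCoef σ x' u' i =
    l2 x * l2 x' * (u ⬝ᵥ u') + l2 u * l2 u' * (x ⬝ᵥ x') := by
  simp only [auxCoef, Fintype.sum_sum_type, dotProduct,
    Finset.mul_sum, zero_mul, Finset.sum_const_zero, zero_add]
  congr 1
  · exact Finset.sum_congr rfl fun k _ => by
      linear_combination (l2 x * u k * (l2 x' * u' k)) * hσ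
  · exact Finset.sum_congr rfl fun i _ => by
      linear_combination (l2 u * x i * (l2 u' * x' i)) * hσ

lemma gram_sub (hσ : σ * σ = 1) : ∑ i, primaryCoef σ x u i * primaryCoef σ x' u' i -
    ∑ i, auxCoef σ x u i * auxCoef σ x' u' i =
      (l2 x * l2 x' - x ⬝ᵥ x') * (l2 u * l2 u' - u ⬝ᵥ u') := by
  rw [primaryCoef_gram _ _ _ _ hσ, auxCoef_gram _ _ _ _ hσ]
  ring

/-- Comparison of the primary and auxiliary processes over countable families. -/
theorem matMeasure_le_two_mul (hn : 0 < n) (hσ : σ * σ = 1) (P : ℕ × ℕ → Fin n → ℝ)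
    (Q : ℕ × ℕ → Fin m → ℝ)
    (hPQ : ∀ j, (∀ k k', P (j, k) = P (j, k')) ∨ ∀ k k', Q (j, k) = Q (j, k'))
    (l : ℕ × ℕ → ℝ) {η : ℝ} (hη : 0 < η) :
    matMeasure m n {H | ∃ j, ∀ k, σ * (√n * (Q (j, k) ⬝ᵥ mulV H (P (j, k)))) ≤ l (j, k)} ≤
      2 * stdGauss (GordonIdx m n) {ξ | ∃ j, ∀ k,
        σ * aoForm (rowVec ξ) (colVec ξ) (P (j, k)) (Q (j, k)) ≤ l (j, k) + η} := by
  have hmeas : MeasurableSet {H : Fin m → Fin n → ℝ |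
      ∃ j, ∀ k, σ * (√n * (Q (j, k) ⬝ᵥ mulV H (P (j, k)))) ≤ l (j, k)} := by
    simp only [Set.ofPred_exists, Set.ofPred_forall]
    refine MeasurableSet.iUnion fun j => MeasurableSet.iInter fun k =>
      (isClosed_le ?_ continuous_const).measurableSet
    simp only [dotProduct, mulV]
    fun_prop
  rw [← (measurePreserving_scaledMat).measure_preimage hmeas.nullMeasurableSet]
  refine (stdGauss_le_two_mul (.inr (.inl ()))
    ((measurePreserving_scaledMat).measurable hmeas) ?_).trans ?_
  · intro ξ a hξ
    have : scaledMat (Function.update ξ (.inr (.inl ())) a) = scaledMat ξ := by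
      ext k i
      simp [scaledMat]
    rwa [Set.mem_preimage, this]
  · refine mul_le_mul_right ?_ 2
    have key := gordon_countable (B := fun p => primaryCoef σ (P p) (Q p))
      (C := fun p => auxCoef σ (P p) (Q p))
      (fun p q i => by rcases i with i | i | i | i <;> simp [primaryCoef, auxCoef])
      (fun j k k' => by
        rw [← sub_eq_zero, gram_sub _ _ _ _ hσ]
        rcases hPQ j with h | h
        · rw [h k k', ← sq, l2_sq, sub_self, zero_mul]
        · rw [h k k', ← sq (l2 (Q _)), l2_sq, sub_self, mul_zero])
      (fun p q => by
        rw [← sub_nonneg, gram_sub _ _ _ _ hσ]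
        exact mul_nonneg (sub_nonneg.2 (dotProduct_le_l2_mul_l2 _ _))
          (sub_nonneg.2 (dotProduct_le_l2_mul_l2 _ _))) l hη
    simp only [sum_primaryCoef_mul _ _ _ hn, sum_auxCoef_mul] at key
    refine (measure_mono ?_).trans key
    rintro ξ ⟨⟨j, hj⟩, hξ⟩
    refine ⟨j, fun k => ?_⟩
    have := mul_nonpos_of_nonneg_of_nonpos
      (mul_nonneg (l2_nonneg (P (j, k))) (l2_nonneg (Q (j, k)))) hξ
    linarith [hj k]

end transfer

section primary

variable {m n : ℕ} {lam ρ A t ε : ℝ} {s : Fin m → ℝ} {H : Fin m → Fin n → ℝ}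

lemma mulV_add_smul (H : Fin m → Fin n → ℝ) (x d : Fin n → ℝ) (θ : ℝ) :
    mulV H (x + θ • d) = mulV H x + θ • mulV H d := by
  ext k
  simp only [mulV, Pi.add_apply, Pi.smul_apply, smul_eq_mul, Finset.mul_sum,
    ← Finset.sum_add_distrib]
  exact Finset.sum_congr rfl fun _ _ => by ring

lemma continuous_mulV (H : Fin m → Fin n → ℝ) : Continuous (mulV H) := by
  unfold mulV; fun_prop

lemma mul_cost (hn : 0 < n) (x : Fin n → ℝ) : n * cost m n lam ρ s H x =
    (mulV H x - √ρ • s) ⬝ᵥ (mulV H x - √ρ • s) + lam * (x ⬝ᵥ x) := by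
  have hn' : (n : ℝ) ≠ 0 := by exact_mod_cast hn.ne'
  simp only [cost, dotProduct, Pi.sub_apply, Pi.smul_apply, smul_eq_mul, ← sq]
  field_simp

lemma continuous_cost : Continuous (cost m n lam ρ s H) := by
  unfold cost mulV; fun_prop

lemma cost_nonneg (hlam : 0 ≤ lam) (x : Fin n → ℝ) : 0 ≤ cost m n lam ρ s H x := by
  unfold cost; positivity

lemma continuous_threshold : Continuous fun p : (Fin n → ℝ) × (Fin m → ℝ) =>
    threshold lam ρ s t p.1 p.2 := by
  unfold threshold; fun_prop

lemma continuous_l2 {k : ℕ} : Continuous (l2 : (Fin k → ℝ) → ℝ) := by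
  unfold l2; fun_prop

lemma continuous_aoForm (g : Fin m → ℝ) (h : Fin n → ℝ) :
    Continuous fun p : (Fin n → ℝ) × (Fin m → ℝ) => aoForm g h p.1 p.2 := by
  have h1 := (continuous_l2 (k := n)).comp (continuous_fst (Y := Fin m → ℝ))
  have h2 := (continuous_l2 (k := m)).comp (continuous_snd (X := Fin n → ℝ))
  unfold aoForm
  simp only [Function.comp_def] at h1 h2
  fun_prop

lemma threshold_add (x : Fin n → ℝ) (u : Fin m → ℝ) :
    threshold lam ρ s (t + ε) x u = threshold lam ρ s t x u + √n / 2 * (n * ε) := by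
  unfold threshold; ring

lemma mul_le_threshold_of_cost_le (hn : 0 < n) {x : Fin n → ℝ} (hx : cost m n lam ρ s H x ≤ t)
    (u : Fin m → ℝ) : √n * (u ⬝ᵥ mulV H x) ≤ threshold lam ρ s t x u := by
  have h1 := mul_le_mul_of_nonneg_left hx (Nat.cast_nonneg n)
  rw [mul_cost hn] at h1
  obtain ⟨y, hy⟩ : ∃ y, y = mulV H x - √ρ • s := ⟨_, rfl⟩
  rw [← hy] at h1
  have e : mulV H x = y + √ρ • s := by rw [hy, sub_add_cancel]
  have h2 := dotProduct_self_nonneg' (y - u)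
  simp only [sub_dotProduct, dotProduct_sub, dotProduct_comm y u] at h2
  rw [e, threshold, dotProduct_add, dotProduct_smul, smul_eq_mul]
  have h3 : 2 * (u ⬝ᵥ y + √ρ * (u ⬝ᵥ s)) ≤
      n * t + 2 * √ρ * (u ⬝ᵥ s) + u ⬝ᵥ u - lam * (x ⬝ᵥ x) := by linarith
  have h4 := mul_le_mul_of_nonneg_left h3 (by positivity : 0 ≤ √(n : ℝ) / 2)
  linarith

lemma isCompact_box : IsCompact {x : Fin n → ℝ | ∀ i, |x i| ≤ A} := by
  have e : {x : Fin n → ℝ | ∀ i, |x i| ≤ A} = Set.univ.pi fun _ => Set.Icc (-A) A := by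
    ext x; simp [abs_le, Pi.le_def, forall_and]
  rw [e]
  exact isCompact_univ_pi fun _ => isCompact_Icc

lemma zero_mem_box (hA : 0 < A) : (0 : Fin n → ℝ) ∈ {x : Fin n → ℝ | ∀ i, |x i| ≤ A} := by
  simp [hA.le]

lemma convex_box : Convex ℝ {x : Fin n → ℝ | ∀ i, |x i| ≤ A} := by
  have e : {x : Fin n → ℝ | ∀ i, |x i| ≤ A} = Set.univ.pi fun _ => Set.Icc (-A) A := by
    ext x; simp [abs_le, Pi.le_def, forall_and]
  rw [e]
  exact convex_pi fun _ _ => convex_Icc _ _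

lemma nonneg_of_forall_mul_add_sq {b c : ℝ} (h : ∀ θ : ℝ, 0 < θ → θ ≤ 1 → 0 ≤ θ * b + θ ^ 2 * c) :
    0 ≤ b := by
  have ht : Filter.Tendsto (fun θ : ℝ => b + θ * c) (nhdsWithin 0 (Set.Ioi 0)) (nhds b) := by
    have : Continuous fun θ : ℝ => b + θ * c := by fun_prop
    simpa using (this.tendsto 0).mono_left nhdsWithin_le_nhds
  refine ge_of_tendsto ht ?_
  filter_upwards [Ioc_mem_nhdsGT (zero_lt_one' ℝ)] with θ hθ
  have := h θ hθ.1 hθ.2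
  exact nonneg_of_mul_nonneg_right (by linarith : 0 ≤ θ * (b + θ * c)) hθ.1

/-- The residual at the minimiser is a dual certificate for the optimal cost. -/
lemma exists_forall_threshold_le (hn : 0 < n) (hlam : 0 ≤ lam) (hA : 0 < A)
    (ht : ∀ x : Fin n → ℝ, (∀ i, |x i| ≤ A) → t ≤ cost m n lam ρ s H x) :
    ∃ u : Fin m → ℝ, ∀ x : Fin n → ℝ, (∀ i, |x i| ≤ A) →
      threshold lam ρ s t x u ≤ √n * (u ⬝ᵥ mulV H x) := by
  obtain ⟨z, hz, hmin⟩ := isCompact_box.exists_isMinOn ⟨0, zero_mem_box (n := n) hA⟩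
    (continuous_cost (lam := lam) (ρ := ρ) (s := s) (H := H)).continuousOn
  set u := mulV H z - √ρ • s with hu
  have hn' : (0 : ℝ) < n := by exact_mod_cast hn
  refine ⟨u, fun x hx => ?_⟩
  set d := x - z with hd
  have hquad : ∀ θ : ℝ, (mulV H (z + θ • d) - √ρ • s) ⬝ᵥ (mulV H (z + θ • d) - √ρ • s) +
      lam * ((z + θ • d) ⬝ᵥ (z + θ • d)) = (u ⬝ᵥ u + lam * (z ⬝ᵥ z)) +
        (θ * (2 * (u ⬝ᵥ mulV H d) + 2 * lam * (z ⬝ᵥ d)) +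
          θ ^ 2 * (mulV H d ⬝ᵥ mulV H d + lam * (d ⬝ᵥ d))) := fun θ => by
    have e : mulV H (z + θ • d) - √ρ • s = u + θ • mulV H d := by
      rw [mulV_add_smul, hu]; abel
    rw [e]
    simp only [add_dotProduct, dotProduct_add, smul_dotProduct, dotProduct_smul, smul_eq_mul,
      dotProduct_comm (mulV H d) u, dotProduct_comm d z]
    ring
  have hfirst : 0 ≤ 2 * (u ⬝ᵥ mulV H d) + 2 * lam * (z ⬝ᵥ d) := by
    refine nonneg_of_forall_mul_add_sq
      (c := mulV H d ⬝ᵥ mulV H d + lam * (d ⬝ᵥ d)) fun θ h0 h1 => ?_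
    have hmem : z + θ • d ∈ {x : Fin n → ℝ | ∀ i, |x i| ≤ A} :=
      convex_box.add_smul_sub_mem hz hx ⟨h0.le, h1⟩
    have h2 := mul_le_mul_of_nonneg_left (hmin hmem) hn'.le
    rw [mul_cost hn, mul_cost hn, hquad, ← hu] at h2
    linarith
  have ht' := mul_le_mul_of_nonneg_left (ht z hz) hn'.le
  rw [mul_cost hn, ← hu] at ht'
  have ex : x = z + (1 : ℝ) • d := by rw [hd, one_smul, add_sub_cancel]
  have hux : u ⬝ᵥ mulV H x = u ⬝ᵥ u + √ρ * (u ⬝ᵥ s) + u ⬝ᵥ mulV H d := by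
    have : mulV H z = u + √ρ • s := by rw [hu, sub_add_cancel]
    rw [ex, mulV_add_smul, one_smul, this, dotProduct_add, dotProduct_add, dotProduct_smul,
      smul_eq_mul]
  have hxx : x ⬝ᵥ x = z ⬝ᵥ z + 2 * (z ⬝ᵥ d) + d ⬝ᵥ d := by
    rw [ex]
    simp only [one_smul, add_dotProduct, dotProduct_add, dotProduct_comm d z]
    ring
  have hdd : 0 ≤ lam * (d ⬝ᵥ d) := mul_nonneg hlam (dotProduct_self_nonneg' d)
  rw [threshold, hux, hxx]
  have h3 : n * t + 2 * √ρ * (u ⬝ᵥ s) + u ⬝ᵥ u - lam * (z ⬝ᵥ z + 2 * (z ⬝ᵥ d) + d ⬝ᵥ d) ≤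
      2 * (u ⬝ᵥ u + √ρ * (u ⬝ᵥ s) + u ⬝ᵥ mulV H d) := by linarith
  have h4 := mul_le_mul_of_nonneg_left h3 (by positivity : 0 ≤ √(n : ℝ) / 2)
  linarith

/-- The lower tail of the optimal cost is controlled by the auxiliary problem. -/
theorem matMeasure_sInf_cost_lt_le (hn : 0 < n) (hA : 0 < A) (hε : 0 < ε) :
    matMeasure m n {H | sInf {v : ℝ | ∃ x : Fin n → ℝ, (∀ i, |x i| ≤ A) ∧
        v = cost m n lam ρ s H x} < t} ≤
      2 * stdGauss (GordonIdx m n) {ξ | ∃ x : Fin n → ℝ, (∀ i, |x i| ≤ A) ∧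
        ∀ u, aoForm (rowVec ξ) (colVec ξ) x u ≤ threshold lam ρ s (t + ε) x u} := by
  let K := {x : Fin n → ℝ | ∀ i, |x i| ≤ A}
  have : Nonempty K := ⟨⟨0, zero_mem_box hA⟩⟩
  let X : ℕ → K := TopologicalSpace.denseSeq K
  let U : ℕ → Fin m → ℝ := TopologicalSpace.denseSeq (Fin m → ℝ)
  have hη : 0 < √(n : ℝ) / 2 * (n * ε) := by
    have : (0 : ℝ) < n := by exact_mod_cast hn
    positivity
  have key := matMeasure_le_two_mul (m := m) hn (one_mul (1 : ℝ)) (fun p => (X p.1 : Fin n → ℝ))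
    (fun p => U p.2) (fun j => Or.inl fun _ _ => rfl)
    (fun p => threshold lam ρ s t (X p.1 : Fin n → ℝ) (U p.2)) hη
  refine (measure_mono ?_).trans (key.trans (mul_le_mul_right (measure_mono ?_) 2))
  · intro H hH
    obtain ⟨_, ⟨x, hx, rfl⟩, hlt⟩ := exists_lt_of_csInf_lt
      (⟨_, 0, zero_mem_box hA, rfl⟩ : Set.Nonempty {v : ℝ | ∃ x : Fin n → ℝ, (∀ i, |x i| ≤ A) ∧
        v = cost m n lam ρ s H x}) hH
    have hopen : IsOpen {x : K | cost m n lam ρ s H x < t} :=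
      isOpen_lt (continuous_cost.comp continuous_subtype_val) continuous_const
    obtain ⟨j, hj⟩ := (TopologicalSpace.denseRange_denseSeq K).exists_mem_open hopen
      ⟨⟨x, hx⟩, hlt⟩
    exact ⟨j, fun k => by
      rw [one_mul]
      exact mul_le_threshold_of_cost_le hn (le_of_lt hj) _⟩
  · rintro ξ ⟨j, hj⟩
    refine ⟨X j, (X j).2, fun u => ?_⟩
    have hc₁ : Continuous fun u : Fin m → ℝ =>
        aoForm (rowVec ξ) (colVec ξ) (X j : Fin n → ℝ) u :=
      (continuous_aoForm _ _).comp (Continuous.prodMk_right _)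
    have hc₂ : Continuous fun u : Fin m → ℝ =>
        threshold lam ρ s (t + ε) (X j : Fin n → ℝ) u :=
      continuous_threshold.comp (Continuous.prodMk_right _)
    refine (TopologicalSpace.denseRange_denseSeq (Fin m → ℝ)).induction_on u
      (isClosed_le hc₁ hc₂) fun k => ?_
    rw [threshold_add]
    simpa only [one_mul] using hj k

/-- The upper tail of the optimal cost is controlled by the auxiliary problem. -/
theorem matMeasure_le_sInf_cost_le (hn : 0 < n) (hlam : 0 ≤ lam) (hA : 0 < A) (hε : 0 < ε) :
    matMeasure m n {H | t ≤ sInf {v : ℝ | ∃ x : Fin n → ℝ, (∀ i, |x i| ≤ A) ∧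
        v = cost m n lam ρ s H x}} ≤
      2 * stdGauss (GordonIdx m n) {ξ | ∃ u : Fin m → ℝ, ∀ x : Fin n → ℝ, (∀ i, |x i| ≤ A) →
        threshold lam ρ s (t - 2 * ε) x u ≤ aoForm (rowVec ξ) (colVec ξ) x u} := by
  let K := {x : Fin n → ℝ | ∀ i, |x i| ≤ A}
  have : Nonempty K := ⟨⟨0, zero_mem_box hA⟩⟩
  have : CompactSpace K := isCompact_iff_compactSpace.1 isCompact_box
  let X : ℕ → K := TopologicalSpace.denseSeq K
  let U : ℕ → Fin m → ℝ := TopologicalSpace.denseSeq (Fin m → ℝ)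
  have hη : 0 < √(n : ℝ) / 2 * (n * ε) := by
    have : (0 : ℝ) < n := by exact_mod_cast hn
    positivity
  have e1 : t = t - ε + ε := by ring
  have e2 : t - ε = t - 2 * ε + ε := by ring
  have key := matMeasure_le_two_mul (m := m) hn (σ := -1) (by norm_num)
    (fun p => (X p.2 : Fin n → ℝ)) (fun p => U p.1) (fun j => Or.inr fun _ _ => rfl)
    (fun p => -threshold lam ρ s (t - ε) (X p.2 : Fin n → ℝ) (U p.1)) hη
  refine (measure_mono ?_).trans (key.trans (mul_le_mul_right (measure_mono ?_) 2))
  · intro H hH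
    obtain ⟨u, hu⟩ := exists_forall_threshold_le (t := t) (m := m) (ρ := ρ) (s := s) (H := H) hn
      hlam hA fun x hx => le_trans hH
        (csInf_le ⟨0, by rintro _ ⟨x, -, rfl⟩; exact cost_nonneg hlam x⟩ ⟨x, hx, rfl⟩)
    have hcont : Continuous fun p : (Fin m → ℝ) × K =>
        √n * (p.1 ⬝ᵥ mulV H p.2) - threshold lam ρ s (t - ε) (p.2 : Fin n → ℝ) p.1 := by
      have h1 := (continuous_mulV H).comp
        (continuous_subtype_val.comp (continuous_snd (X := Fin m → ℝ) (Y := K)))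
      have h2 := (continuous_threshold (lam := lam) (ρ := ρ) (s := s) (t := t - ε)).comp
        ((continuous_subtype_val.comp (continuous_snd (X := Fin m → ℝ) (Y := K))).prodMk
          continuous_fst)
      simp only [Function.comp_def] at h1 h2
      fun_prop
    have hev : ∀ᶠ v in nhds u, ∀ x ∈ (Set.univ : Set K),
        0 < √n * (v ⬝ᵥ mulV H x) - threshold lam ρ s (t - ε) (x : Fin n → ℝ) v := by
      refine isCompact_univ.eventually_forall_of_forall_eventually fun x _ => ?_
      refine hcont.continuousAt.eventually_const_lt ?_
      have := hu x x.2
      rw [e1, threshold_add] at this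
      dsimp only
      linarith
    obtain ⟨_, ⟨j, rfl⟩, hj⟩ :=
      (TopologicalSpace.denseRange_denseSeq (Fin m → ℝ)).inter_nhds_nonempty hev
    exact ⟨j, fun k => by
      have := hj (X k) (Set.mem_univ _)
      linarith⟩
  · rintro ξ ⟨j, hj⟩
    refine ⟨U j, fun x hx => ?_⟩
    have hc₁ : Continuous fun x : K => threshold lam ρ s (t - 2 * ε) (x : Fin n → ℝ) (U j) :=
      continuous_threshold.comp ((Continuous.prodMk_left _).comp continuous_subtype_val)
    have hc₂ : Continuous fun x : K =>
        aoForm (rowVec ξ) (colVec ξ) (x : Fin n → ℝ) (U j) :=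
      (continuous_aoForm _ _).comp ((Continuous.prodMk_left _).comp continuous_subtype_val)
    have hall : ∀ x : K, threshold lam ρ s (t - 2 * ε) (x : Fin n → ℝ) (U j) ≤
        aoForm (rowVec ξ) (colVec ξ) (x : Fin n → ℝ) (U j) := fun x => by
      refine (TopologicalSpace.denseRange_denseSeq K).induction_on x
        (isClosed_le hc₁ hc₂) fun k => ?_
      have := hj k
      simp only [e2, threshold_add] at this
      linarith
    exact hall ⟨x, hx⟩

end primary

/-- A family of events has probability at most `C / ε * exp (-c n ε²)`, uniformly in the dimensions
and in the sign vector. -/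
def HasTail (δ : ℝ) (E : ∀ m n : ℕ, (Fin m → ℝ) → ℝ → Set (GordonIdx m n → ℝ)) : Prop :=
  ∃ C c : ℝ, 0 < C ∧ 0 < c ∧ ∀ m n : ℕ, 0 < n → (m : ℝ) = δ * n →
    ∀ s : Fin m → ℝ, (∀ k, s k = 1 ∨ s k = -1) → ∀ ε : ℝ, 0 < ε → ε < 1 →
      (stdGauss (GordonIdx m n)).real (E m n s ε) ≤ C / ε * exp (-c * n * ε ^ 2)

section tail

variable {δ lam A : ℝ} {E E' : ∀ m n : ℕ, (Fin m → ℝ) → ℝ → Set (GordonIdx m n → ℝ)}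

lemma HasTail.union (h : HasTail δ E) (h' : HasTail δ E') :
    HasTail δ fun m n s ε => E m n s ε ∪ E' m n s ε := by
  obtain ⟨C, c, hC, hc, hE⟩ := h
  obtain ⟨C', c', hC', hc', hE'⟩ := h'
  refine ⟨C + C', min c c', by positivity, lt_min hc hc', fun m n hn hm s hs ε hε hε1 => ?_⟩
  have key : ∀ d, min c c' ≤ d → exp (-d * n * ε ^ 2) ≤ exp (-(min c c') * n * ε ^ 2) := by
    intro d hd
    gcongr
  calc _ ≤ _ := measureReal_union_le _ _
    _ ≤ C / ε * exp (-c * n * ε ^ 2) + C' / ε * exp (-c' * n * ε ^ 2) :=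
      add_le_add (hE m n hn hm s hs ε hε hε1) (hE' m n hn hm s hs ε hε hε1)
    _ ≤ C / ε * exp (-(min c c') * n * ε ^ 2) + C' / ε * exp (-(min c c') * n * ε ^ 2) := by
      gcongr ?_ * ?_ + ?_ * ?_
      · exact key c (min_le_left _ _)
      · exact key c' (min_le_right _ _)
    _ = _ := by ring

lemma hasTail_of_le_two_mul {c : ℝ} (hc : 0 < c)
    (h : ∀ m n : ℕ, 0 < n → (m : ℝ) = δ * n → ∀ s : Fin m → ℝ, (∀ k, s k = 1 ∨ s k = -1) →
      ∀ ε : ℝ, 0 < ε → ε < 1 →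
        (stdGauss (GordonIdx m n)).real (E m n s ε) ≤ 2 * exp (-c * n * ε ^ 2)) : HasTail δ E := by
  refine ⟨2, c, two_pos, hc, fun m n hn hm s hs ε hε hε1 => (h m n hn hm s hs ε hε hε1).trans ?_⟩
  gcongr
  rw [le_div_iff₀ hε]
  linarith

lemma rowIdx_injective {m n : ℕ} :
    Function.Injective fun k : Fin m => (.inr (.inr (.inl k)) : GordonIdx m n) :=
  fun _ _ h => by simpa using h

lemma colIdx_injective {m n : ℕ} :
    Function.Injective fun i : Fin n => (.inr (.inr (.inr i)) : GordonIdx m n) :=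
  fun _ _ h => by simpa using h

lemma hasTail_sum_sq (hδ : 0 < δ) :
    HasTail δ fun _ n _ ε => {ξ | n * ε ≤ |∑ k, (rowVec ξ k ^ 2 - 1)|} := by
  set κ := 1 / (8 * δ + 4) with hκ
  have hκ0 : 0 < κ := by positivity
  have hκ4 : κ * (8 * δ + 4) = 1 := by rw [hκ]; field_simp
  refine hasTail_of_le_two_mul (half_pos hκ0) fun m n hn hm s hs ε hε hε1 => ?_
  have hδκ := mul_pos hδ hκ0
  have ht : κ * ε ≤ 1 / 4 := by nlinarith
  refine (measure_abs_sum_sq_sub_ge rowIdx_injective (by positivity) ht).trans ?_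
  gcongr
  rw [hm]
  have h1 : 0 ≤ κ * n * ε ^ 2 := by positivity
  have h2 : δ * n * (4 * (κ * ε) ^ 2) = (κ * n * ε ^ 2) * (4 * (δ * κ)) := by ring
  have h3 : 4 * (δ * κ) ≤ 1 / 2 := by linarith
  have h4 := mul_le_mul_of_nonneg_left h3 h1
  rw [h2]
  linarith

lemma hasTail_sum_sign_mul (hδ : 0 < δ) :
    HasTail δ fun _ n s ε => {ξ | n * ε ≤ |∑ k, s k * rowVec ξ k|} := by
  refine hasTail_of_le_two_mul (c := 1 / (4 * δ)) (by positivity) fun m n hn hm s hs ε hε hε1 => ?_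
  have hn' : (0 : ℝ) < n := by exact_mod_cast hn
  have hL : ∀ k, LipschitzWith 1 fun x : ℝ => s k * x := fun k =>
    LipschitzWith.of_dist_le_mul fun x y => by
      rw [Real.dist_eq, Real.dist_eq, ← mul_sub, abs_mul]
      rcases hs k with h | h <;> simp [h]
  have key := measure_abs_sum_sub_integral_ge (rowIdx_injective (n := n)) hL
    (a := n * ε) (by positivity)
  have hintg : ∀ k, ∫ x, s k * x ∂(gaussianReal 0 1) = 0 := fun k => by
    rw [MeasureTheory.integral_const_mul, integral_id_gaussianReal, mul_zero]
  simp only [hintg, sub_zero] at key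
  refine key.trans (le_of_eq ?_)
  congr 2
  rw [hm]
  push_cast
  field_simp

lemma hasTail_of_exists_uniform_tail {F : ℝ → ℝ → ℝ} {a b K : ℝ} {L : ℝ} (hab : a < b)
    (hK : 0 ≤ K) (hF : ∀ r ∈ Set.Icc a b, ∀ M : ℝ≥0, L ≤ M → LipschitzWith M (F r))
    (hr : ∀ r r' x, |F r x - F r' x| ≤ K * (1 + |x|) * |r - r'|) :
    HasTail δ fun _ n _ ε => {ξ | ∃ r ∈ Set.Icc a b,
      n * ε ≤ |∑ i, (F r (colVec ξ i) - ∫ x, F r x ∂(gaussianReal 0 1))|} := by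
  obtain ⟨C, c, hC, hc, h⟩ := exists_uniform_tail (L := max 1 L.toNNReal) hab hK (le_max_left _ _)
    (fun r hr => hF r hr _ ((Real.le_coe_toNNReal L).trans (by exact_mod_cast le_max_right _ _)))
    fun r _ r' _ x => hr r r' x
  exact ⟨C, c, hC, hc, fun m n hn _ s _ ε hε hε1 => h hn colIdx_injective ε hε hε1⟩

lemma hasTail_innerMin_left {a b : ℝ} (hA : 0 < A) (hab : a < b) (β : ℝ) :
    HasTail δ fun _ n _ ε => {ξ | ∃ r ∈ Set.Icc a b, n * ε ≤ |∑ i, (innerMin lam A r β (colVec ξ i) -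
      ∫ y, innerMin lam A r β y ∂(gaussianReal 0 1))|} :=
  hasTail_of_exists_uniform_tail (F := fun r => innerMin lam A r β) (K := |β| * A ^ 2) hab
    (by positivity) (fun _ _ _ hM => lipschitzWith_innerMin hA hM)
    fun _ r' _ => innerMin_sub_le_of_r hA r'

lemma hasTail_innerMin_right {B : ℝ} (hA : 0 < A) (hB : 0 < B) (r : ℝ) :
    HasTail δ fun _ n _ ε => {ξ | ∃ β ∈ Set.Icc 0 B, n * ε ≤ |∑ i, (innerMin lam A r β (colVec ξ i) -
      ∫ y, innerMin lam A r β y ∂(gaussianReal 0 1))|} :=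
  hasTail_of_exists_uniform_tail (F := fun β => innerMin lam A r β) (K := |r| * A ^ 2 + A)
    (L := B * A) hB (by positivity)
    (fun β hβ _ hM => lipschitzWith_innerMin hA (le_trans (by
      rw [abs_of_nonneg hβ.1]
      exact mul_le_mul_of_nonneg_right hβ.2 hA.le) hM))
    fun _ β' _ => innerMin_sub_le_of_beta hA β'

end tail

/-- concentration of the optimal cost `min_{‖x‖∞ ≤ A} P(x; ρ)` around
`φ(τ*, β*; ρ, A)`. -/
theorem stmt2 (δ lam ρ A : ℝ) (hδ : 0 < δ) (hlam : 0 ≤ lam) (hρ : 0 < ρ) (hA : 0 < A)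
    (hcond : 0 < lam ∨ (lam = 0 ∧ 1 ≤ δ))
    (τs βs : ℝ) (hsaddle : IsSaddle δ lam ρ A τs βs) :
    ∃ C c γ ε₀ : ℝ, 0 < C ∧ 0 < c ∧ 0 < γ ∧ 0 < ε₀ ∧ ε₀ < 1 ∧
      ∀ (n m : ℕ), (m : ℝ) = δ * n →
        ∀ s : Fin m → ℝ, (∀ k, s k = 1 ∨ s k = -1) →
          ∀ ε : ℝ, 0 < ε → ε < ε₀ →
            matMeasure m n
                {H : Fin m → Fin n → ℝ | γ * ε ≤
                  |sInf {v : ℝ | ∃ x : Fin n → ℝ, (∀ i, |x i| ≤ A) ∧ v = cost m n lam ρ s H x} -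
                    phiFn δ lam ρ A τs βs|} ≤
              ENNReal.ofReal (C / ε * Real.exp (-c * n * ε ^ 2)) := by
  obtain ⟨hτ, hβ, hmin, hmax⟩ := hsaddle
  set φ₀ := phiFn δ lam ρ A τs βs with hφ₀
  set K₂ := (A ^ 2 + 2 * √ρ * A) / (2 * τs * δ) with hK₂
  have hK₂0 : 0 < K₂ := by positivity
  set B := 4 * (τs * δ / 2 + ρ / (2 * τs) + K₂) with hB
  have hB0 : 0 < B := by positivity
  set K₁ := βs * ((A ^ 2 + 2 * √ρ * A) / √(δ * ρ)) with hK₁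
  have hK₁0 : 0 < K₁ := by positivity
  have hab : δ / (2 * √(δ * (ρ + A ^ 2))) < δ / (2 * √(δ * ρ)) := by
    have h1 : 0 < √(δ * ρ) := sqrt_pos.2 (by positivity)
    have h2 : √(δ * ρ) < √(δ * (ρ + A ^ 2)) := by
      refine sqrt_lt_sqrt (by positivity) (mul_lt_mul_of_pos_left ?_ hδ)
      linarith [pow_pos hA 2]
    gcongr
  obtain ⟨C, c, hC, hc, htail⟩ := (hasTail_sum_sq hδ).union <| (hasTail_sum_sign_mul hδ).union <|
    (hasTail_innerMin_left (lam := lam) hA hab βs).union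
      (hasTail_innerMin_right (lam := lam) hA hB0 (2 * τs)⁻¹)
  refine ⟨max 1 (4 * C), c, 5 + K₁ + B * K₂, 1 / 2, by positivity, hc, by positivity, by norm_num,
    by norm_num, fun n m hm s hs ε hε hε2 => ?_⟩
  have hε1 : ε < 1 := hε2.trans (by norm_num)
  rcases n.eq_zero_or_pos with rfl | hn
  · have : IsProbabilityMeasure (matMeasure m 0) := by unfold matMeasure; infer_instance
    refine prob_le_one.trans ?_
    rw [ENNReal.one_le_ofReal]
    simp only [Nat.cast_zero, mul_zero, zero_mul, exp_zero, mul_one]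
    rw [le_div_iff₀ hε]
    linarith [le_max_left 1 (4 * C)]
  have hbad := htail m n hn hm s hs ε hε hε1
  dsimp only at hbad
  generalize hbad_def : (_ ∪ _ : Set (GordonIdx m n → ℝ)) = bad at hbad
  have hgood : ∀ ξ ∉ bad, |∑ k, (rowVec ξ k ^ 2 - 1)| < n * ε ∧ |∑ k, s k * rowVec ξ k| < n * ε ∧
      (∀ r ∈ Set.Icc (δ / (2 * √(δ * (ρ + A ^ 2)))) (δ / (2 * √(δ * ρ))),
        |∑ i, (innerMin lam A r βs (colVec ξ i) -
          ∫ y, innerMin lam A r βs y ∂(gaussianReal 0 1))| < n * ε) ∧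
      ∀ β ∈ Set.Icc 0 B, |∑ i, (innerMin lam A (2 * τs)⁻¹ β (colVec ξ i) -
        ∫ y, innerMin lam A (2 * τs)⁻¹ β y ∂(gaussianReal 0 1))| < n * ε := by
    intro ξ hξ
    simpa only [← hbad_def, Set.mem_union, Set.mem_ofPred_eq, not_or, not_le, not_exists, not_and]
      using hξ
  have hlower := (matMeasure_sInf_cost_lt_le (m := m) (lam := lam) (ρ := ρ) (s := s)
    (t := φ₀ - (5 + K₁ + B * K₂) * ε + ε) hn hA hε).trans
      (mul_le_mul_right (measure_mono (t := bad) (by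
        rintro ξ ⟨x, hx, hAO⟩
        by_contra hξ
        obtain ⟨h1, h2, h3, -⟩ := hgood ξ hξ
        have := le_of_aoForm_le hδ hρ hA hn hm hs hε hβ hmin h1 h2 h3 hx hAO
        rw [← hK₁] at this
        have h4 : 0 < B * K₂ * ε := by positivity
        linarith)) 2)
  have hupper := (matMeasure_le_sInf_cost_le (m := m) (ρ := ρ) (s := s)
    (t := φ₀ + (5 + K₁ + B * K₂) * ε) hn hlam hA hε).trans
      (mul_le_mul_right (measure_mono (t := bad) (by
        rintro ξ ⟨u, hAO⟩
        by_contra hξ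
        obtain ⟨h1, h2, -, h3⟩ := hgood ξ hξ
        have := le_of_le_aoForm hδ hlam hρ hA hn hm hs hε hε1 hτ hmax hK₂ hB h1 h2 h3 hAO
        have h4 : 0 < K₁ * ε := by positivity
        linarith)) 2)
  refine (measure_mono ?_).trans ((measure_union_le _ _).trans
    ((add_le_add hlower hupper).trans ?_))
  · intro H hH
    rcases le_abs.1 (Set.mem_ofPred_eq ▸ hH) with h | h
    · exact Or.inr (by rw [Set.mem_ofPred_eq]; linarith)
    · exact Or.inl (by rw [Set.mem_ofPred_eq]; linarith)
  · rw [← add_mul, ← ofReal_measureReal, show (2 : ℝ≥0∞) + 2 = ENNReal.ofReal 4 by norm_num,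
      ← ENNReal.ofReal_mul (by norm_num)]
    refine ENNReal.ofReal_le_ofReal ((mul_le_mul_of_nonneg_left hbad (by norm_num)).trans ?_)
    rw [← mul_assoc, ← mul_div_assoc]
    gcongr
    exact le_max_right _ _
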